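/- arXiv:2308.06660 — 2 statements merged into one kernel-verified Lean document; each statement's English description precedes it below -/
import Mathlib

section
/- Let 𝔉 be a Fraïssé class. Let 𝔟₁^min be the ideal of P generated by the elements L(D) over all minimal L-data D, and let 𝔟₂^min be the ideal of P generated by the elements Q(D) over all minimal Q-data D. Then the assignment ⟦X,a⟧ ↦ [X,a] induces a ring isomorphism P/(𝔟₀ + 𝔟₁^min + 𝔟₂^min) → Θ(𝔉). -/
/-! # Relational structures, embeddings, amalgamations, Fraïssé classes -/

namespace Paper

/-- A relational signature: a set `I` of relation symbols with arities `≥ 1`. -/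
structure Signature : Type 1 where
  I : Type
  arity : I → ℕ
  arity_pos : ∀ i, 1 ≤ arity i

variable {σ : Signature}

/-- A (finite relational) structure for the signature `σ`. -/
structure Struc (σ : Signature) : Type 1 where
  carrier : Type
  [fin : Finite carrier]
  rel : ∀ i : σ.I, (Fin (σ.arity i) → carrier) → Prop

attribute [instance] Struc.fin

/-- An embedding of structures: an injection under which the relations on the source are
exactly the restrictions of the relations on the target. -/
structure Emb (X Y : Struc σ) : Type where
  toFun : X.carrier → Y.carrier
  inj : Function.Injective toFun
  rel_iff : ∀ (i : σ.I) (v : Fin (σ.arity i) → X.carrier),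
    Y.rel i (fun j => toFun (v j)) ↔ X.rel i v

/-- The identity embedding. -/
def Emb.id (X : Struc σ) : Emb X X where
  toFun := fun x => x
  inj := fun _ _ h => h
  rel_iff := fun _ _ => Iff.rfl

/-- Composition of embeddings. -/
def Emb.comp {X Y Z : Struc σ} (g : Emb Y Z) (f : Emb X Y) : Emb X Z where
  toFun := fun x => g.toFun (f.toFun x)
  inj := fun _ _ h => f.inj (g.inj h)
  rel_iff := fun i v => (g.rel_iff i fun j => f.toFun (v j)).trans (f.rel_iff i v)

/-- An embedding is an isomorphism if it is surjective. -/
def Emb.IsIso {X Y : Struc σ} (f : Emb X Y) : Prop := Function.Surjective f.toFun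

/-- Two structures are isomorphic. -/
def StrucIso (X Y : Struc σ) : Prop := ∃ f : Emb X Y, f.IsIso

theorem strucIso_refl (X : Struc σ) : StrucIso X X := ⟨Emb.id X, fun y => ⟨y, rfl⟩⟩

/-- The induced structure on a subset of the carrier. -/
def Struc.restrict (X : Struc σ) (S : Set X.carrier) : Struc σ where
  carrier := S
  rel := fun i v => X.rel i (fun j => (v j : X.carrier))

/-- The inclusion embedding of an induced substructure into the whole structure. -/
def Struc.subEmb (X : Struc σ) (S : Set X.carrier) : Emb (X.restrict S) X where
  toFun := fun a => a.1
  inj := fun _ _ h => Subtype.ext h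
  rel_iff := fun _ _ => Iff.rfl

/-- The inclusion embedding between induced substructures on nested subsets. -/
def Struc.inclEmb (X : Struc σ) {S T : Set X.carrier} (h : S ⊆ T) :
    Emb (X.restrict S) (X.restrict T) where
  toFun := fun a => ⟨a.1, h a.2⟩
  inj := fun a b hab => Subtype.ext (Subtype.mk_eq_mk.mp (by exact hab))
  rel_iff := fun _ _ => Iff.rfl

/-- An amalgamation of `Y₁` and `Y₂` over `X` (along `i₁`, `i₂`). -/
structure Amalg {X Y₁ Y₂ : Struc σ} (i₁ : Emb X Y₁) (i₂ : Emb X Y₂) : Type 1 where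
  Z : Struc σ
  j₁ : Emb Y₁ Z
  j₂ : Emb Y₂ Z
  comm : ∀ x, j₁.toFun (i₁.toFun x) = j₂.toFun (i₂.toFun x)
  surj : ∀ z, z ∈ Set.range j₁.toFun ∪ Set.range j₂.toFun

/-- Isomorphism of amalgamations: a structure isomorphism commuting with the two
embeddings. -/
def Amalg.Iso {X Y₁ Y₂ : Struc σ} {i₁ : Emb X Y₁} {i₂ : Emb X Y₂}
    (A B : Amalg i₁ i₂) : Prop :=
  ∃ f : Emb A.Z B.Z, f.IsIso ∧ (∀ y, f.toFun (A.j₁.toFun y) = B.j₁.toFun y) ∧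
    (∀ y, f.toFun (A.j₂.toFun y) = B.j₂.toFun y)

/-- A structure lies in the class `F` up to isomorphism. -/
def MemUpIso (F : Set (Struc σ)) (X : Struc σ) : Prop := ∃ W ∈ F, StrucIso X W

theorem memUpIso_of_mem {F : Set (Struc σ)} {X : Struc σ} (h : X ∈ F) : MemUpIso F X :=
  ⟨X, h, strucIso_refl X⟩

/-- A Fraïssé class. -/
structure IsFraisse (F : Set (Struc σ)) : Prop where
  nonempty : F.Nonempty
  finClasses : ∀ n : ℕ, ∃ (m : ℕ) (r : Fin m → Struc σ),
    ∀ X ∈ F, Nat.card X.carrier = n → ∃ α, StrucIso X (r α)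
  hereditary : ∀ X ∈ F, ∀ Y : Struc σ, Nonempty (Emb Y X) → MemUpIso F Y
  amalg : ∀ (X Y₁ Y₂ : Struc σ), X ∈ F → Y₁ ∈ F → Y₂ ∈ F →
    ∀ (i₁ : Emb X Y₁) (i₂ : Emb X Y₂), ∃ A : Amalg i₁ i₂, MemUpIso F A.Z

theorem pair_compl_subset_left {α : Type*} (a b : α) : ({a, b} : Set α)ᶜ ⊆ ({a} : Set α)ᶜ :=
  Set.compl_subset_compl.mpr (fun _ hx => Set.mem_insert_iff.mpr (Or.inl hx))

theorem pair_compl_subset_right {α : Type*} (a b : α) : ({a, b} : Set α)ᶜ ⊆ ({b} : Set α)ᶜ :=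
  Set.compl_subset_compl.mpr (fun _ hx => Set.mem_insert_iff.mpr (Or.inr hx))

/-- The canonical amalgamation of `X∖{a}` and `X∖{b}` over `X∖{a,b}`, namely `X` itself. -/
def canonAmalg (X : Struc σ) (a b : X.carrier) (hab : a ≠ b) :
    Amalg (X.inclEmb (pair_compl_subset_left a b)) (X.inclEmb (pair_compl_subset_right a b)) where
  Z := X
  j₁ := X.subEmb ({a} : Set X.carrier)ᶜ
  j₂ := X.subEmb ({b} : Set X.carrier)ᶜ
  comm := fun _ => rfl
  surj := fun z => by
    by_cases hz : z = a
    · exact Or.inr ⟨⟨z, by simp only [Set.mem_compl_iff, Set.mem_singleton_iff, hz]; exact hab⟩, rfl⟩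
    · exact Or.inl ⟨⟨z, by simp [hz]⟩, rfl⟩

/-- Two distinct elements `a b` of `X` are separated (relative to the class `F`) if `X` is,
up to isomorphism of amalgamations, the unique amalgamation of `X∖{a}` and `X∖{b}` over
`X∖{a,b}` lying in `F`. -/
def Separated (F : Set (Struc σ)) (X : Struc σ) (a b : X.carrier) (hab : a ≠ b) : Prop :=
  ∀ A : Amalg (X.inclEmb (pair_compl_subset_left a b)) (X.inclEmb (pair_compl_subset_right a b)),
    MemUpIso F A.Z → A.Iso (canonAmalg X a b hab)

/-- Stably separated: every embedding into a member of `F` sends `a`, `b` to separated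
elements. -/
def StablySeparated (F : Set (Struc σ)) (X : Struc σ) (a b : X.carrier) (hab : a ≠ b) : Prop :=
  ∀ X' : Struc σ, MemUpIso F X' → ∀ f : Emb X X',
    Separated F X' (f.toFun a) (f.toFun b) (fun h => hab (f.inj h))

/-- Isomorphism of marked structures. -/
def MarkedIso (X : Struc σ) (a : X.carrier) (Y : Struc σ) (b : Y.carrier) : Prop :=
  ∃ f : Emb X Y, f.IsIso ∧ f.toFun a = b

/-- `b` is extraneous in the marked structure `(X, a)` if it is separated from `a`. -/
def Extraneous (F : Set (Struc σ)) (X : Struc σ) (a b : X.carrier) : Prop :=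
  ∃ h : a ≠ b, Separated F X a b h

/-- A marked structure is minimal if it has no extraneous elements. -/
def MinimalMarked (F : Set (Struc σ)) (X : Struc σ) (a : X.carrier) : Prop :=
  ∀ b : X.carrier, ¬ Extraneous F X a b

/-- `f : W → X` is a one-point extension missing exactly `a`. -/
def IsOnePointExt {W X : Struc σ} (f : Emb W X) (a : X.carrier) : Prop :=
  Set.range f.toFun = ({a} : Set X.carrier)ᶜ

end Paper

/-! # The ring `Θ(𝔉)` of a Fraïssé class -/

namespace Paper

variable {σ : Signature}

/-- Generators of `Θ(𝔉)`: one for each embedding between members of `𝔉`. -/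
def ThetaGen (F : Set (Struc σ)) : Type 1 :=
  Σ (X : {X : Struc σ // X ∈ F}) (Y : {Y : Struc σ // Y ∈ F}), Emb X.1 Y.1

/-- The polynomial ring on the generators of `Θ(𝔉)`. -/
abbrev ThetaPoly (F : Set (Struc σ)) := MvPolynomial (ThetaGen F) ℤ

/-- The generator `[i]` for an embedding `i : X → Y` between members of `𝔉`. -/
noncomputable def thetaVar {F : Set (Struc σ)} (X Y : Struc σ) (hX : X ∈ F) (hY : Y ∈ F)
    (f : Emb X Y) : ThetaPoly F :=
  MvPolynomial.X ⟨⟨X, hX⟩, ⟨Y, hY⟩, f⟩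

/-- The defining relations of `Θ(𝔉)`: `[i] = 1` for isomorphisms, `[j∘i] = [j]·[i]`,
and the amalgamation relations `[i] = Σ_α [i'_α]` where `i'_α` runs over a complete
irredundant system of representatives of the isomorphism classes of amalgamations
lying in `𝔉`. -/
def ThetaRels (F : Set (Struc σ)) : Set (ThetaPoly F) :=
  {p | ∃ (X Y : Struc σ) (hX : X ∈ F) (hY : Y ∈ F) (f : Emb X Y),
      f.IsIso ∧ p = thetaVar X Y hX hY f - 1} ∪
  {p | ∃ (X Y Z : Struc σ) (hX : X ∈ F) (hY : Y ∈ F) (hZ : Z ∈ F)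
      (f : Emb X Y) (g : Emb Y Z),
      p = thetaVar X Z hX hZ (g.comp f) - thetaVar Y Z hY hZ g * thetaVar X Y hX hY f} ∪
  {p | ∃ (X Y X' : Struc σ) (hX : X ∈ F) (hY : Y ∈ F) (hX' : X' ∈ F)
      (i : Emb X Y) (f : Emb X X') (m : ℕ) (r : Fin m → Amalg i f)
      (hr : ∀ α, (r α).Z ∈ F),
      (∀ A : Amalg i f, MemUpIso F A.Z → ∃ α, A.Iso (r α)) ∧
      (∀ α β, (r α).Iso (r β) → α = β) ∧
      p = thetaVar X Y hX hY i - ∑ α, thetaVar X' (r α).Z hX' (hr α) ((r α).j₂)}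

/-- The ring `Θ(𝔉)`. -/
abbrev ThetaRing (F : Set (Struc σ)) : Type 1 :=
  ThetaPoly F ⧸ Ideal.span (ThetaRels F)

/-- The class `[i] ∈ Θ(𝔉)` of an embedding between members of `𝔉`. -/
noncomputable def thetaClass {F : Set (Struc σ)} (X Y : Struc σ) (hX : X ∈ F) (hY : Y ∈ F)
    (f : Emb X Y) : ThetaRing F :=
  Ideal.Quotient.mk _ (thetaVar X Y hX hY f)

end Paper

/-! # The polynomial ring `P` on marked structures, L-data and Q-data -/

namespace Paper

open scoped Classical

variable {σ : Signature}

theorem memUpIso_restrict {F : Set (Struc σ)} (hF : IsFraisse F) {X : Struc σ}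
    (hX : MemUpIso F X) (S : Set X.carrier) : MemUpIso F (X.restrict S) := by
  obtain ⟨W, hW, f, hf⟩ := hX
  exact hF.hereditary W hW _ ⟨f.comp (X.subEmb S)⟩

/-- Marked structures whose underlying structure lies in `F` (up to isomorphism). -/
def MarkedIn (F : Set (Struc σ)) : Type 1 :=
  Σ X : {X : Struc σ // MemUpIso F X}, X.1.carrier

/-- Isomorphism of marked structures, as a relation on `MarkedIn F`. -/
def markedInRel (F : Set (Struc σ)) (p q : MarkedIn F) : Prop :=
  MarkedIso p.1.1 p.2 q.1.1 q.2

/-- Isomorphism classes of marked structures in `F`. -/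
def MarkedCls (F : Set (Struc σ)) : Type 1 := Quot (markedInRel F)

/-- The polynomial ring `P` over `ℤ` with one variable for each isomorphism class of
marked structures in `F`. -/
abbrev PRing (F : Set (Struc σ)) : Type 1 := MvPolynomial (MarkedCls F) ℤ

/-- The variable `⟦X,a⟧` of `P`. -/
noncomputable def mVar {F : Set (Struc σ)} (X : Struc σ) (hX : MemUpIso F X)
    (a : X.carrier) : PRing F :=
  MvPolynomial.X (Quot.mk _ ⟨⟨X, hX⟩, a⟩)

/-- For an L-datum `((X,a),(Y,b),i)`: the isomorphism `i : X∖{a} → Y∖{b}` extends to an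
isomorphism `X → Y`. -/
def LExtends {X Y : Struc σ} {a : X.carrier} {b : Y.carrier}
    (i : Emb (X.restrict ({a} : Set X.carrier)ᶜ) (Y.restrict ({b} : Set Y.carrier)ᶜ)) :
    Prop :=
  ∃ g : Emb X Y, g.IsIso ∧
    ∀ w : (X.restrict ({a} : Set X.carrier)ᶜ).carrier, g.toFun w.1 = (i.toFun w).1

/-- `p` is the element `L((X,a),(Y,b),i) = ⟦X,a⟧ − δ − Σ_α ⟦X_α,a⟧` of `P` associated to
the L-datum `((X,a),(Y,b),i)`, computed with respect to some complete irredundant system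
of representatives `X_α` of the isomorphism classes of amalgamations of `X` and `Y` over
`X∖{a} ≅ Y∖{b}` lying in `F` in which `a` and `b` remain distinct. -/
def IsLElt (F : Set (Struc σ)) {X Y : Struc σ} (hX : MemUpIso F X) (hY : MemUpIso F Y)
    (a : X.carrier) (b : Y.carrier)
    (i : Emb (X.restrict ({a} : Set X.carrier)ᶜ) (Y.restrict ({b} : Set Y.carrier)ᶜ))
    (p : PRing F) : Prop :=
  ∃ (m : ℕ)
    (r : Fin m → Amalg (X.subEmb ({a} : Set X.carrier)ᶜ)
      ((Y.subEmb ({b} : Set Y.carrier)ᶜ).comp i))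
    (hr : ∀ α, MemUpIso F (r α).Z),
    (∀ α, (r α).j₁.toFun a ≠ (r α).j₂.toFun b) ∧
    (∀ A : Amalg (X.subEmb ({a} : Set X.carrier)ᶜ)
        ((Y.subEmb ({b} : Set Y.carrier)ᶜ).comp i),
      MemUpIso F A.Z → A.j₁.toFun a ≠ A.j₂.toFun b → ∃ α, A.Iso (r α)) ∧
    (∀ α β, (r α).Iso (r β) → α = β) ∧
    p = mVar X hX a - (if LExtends i then 1 else 0) -
      ∑ α, mVar (r α).Z (hr α) ((r α).j₁.toFun a)

/-- The element `Q(X,a,b) = ⟦X,a⟧·⟦X∖{a},b⟧ − ⟦X,b⟧·⟦X∖{b},a⟧` of `P` associated to a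
Q-datum `(X,a,b)`. -/
noncomputable def qElt {F : Set (Struc σ)} (X : Struc σ) (hX : MemUpIso F X)
    (a b : X.carrier) (hab : a ≠ b)
    (ha : MemUpIso F (X.restrict ({a} : Set X.carrier)ᶜ))
    (hb : MemUpIso F (X.restrict ({b} : Set X.carrier)ᶜ)) : PRing F :=
  mVar X hX a * mVar _ ha ⟨b, Set.mem_compl_singleton_iff.mpr (Ne.symm hab)⟩ -
    mVar X hX b * mVar _ hb ⟨a, Set.mem_compl_singleton_iff.mpr hab⟩

/-- The generators of the ideal `𝔟₀`: the differences `⟦X,a⟧ − ⟦X∖{b},a⟧` over all marked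
structures `(X,a)` with an extraneous element `b`. -/
def B0Set (F : Set (Struc σ)) : Set (PRing F) :=
  {p | ∃ (X : Struc σ) (hX : MemUpIso F X) (a b : X.carrier) (h : a ≠ b),
    Separated F X a b h ∧
    ∃ h' : MemUpIso F (X.restrict ({b} : Set X.carrier)ᶜ),
      p = mVar X hX a -
        mVar (X.restrict ({b} : Set X.carrier)ᶜ) h'
          ⟨a, Set.mem_compl_singleton_iff.mpr h⟩}

/-- The generators of the ideal `𝔟₁`: the elements `L(D)` over all L-data `D`. -/
def LSet (F : Set (Struc σ)) : Set (PRing F) :=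
  {p | ∃ (X Y : Struc σ) (hX : MemUpIso F X) (hY : MemUpIso F Y)
    (a : X.carrier) (b : Y.carrier)
    (i : Emb (X.restrict ({a} : Set X.carrier)ᶜ) (Y.restrict ({b} : Set Y.carrier)ᶜ)),
    i.IsIso ∧ IsLElt F hX hY a b i p}

/-- The generators of the ideal `𝔟₂`: the elements `Q(D)` over all Q-data `D`. -/
def QSet (F : Set (Struc σ)) : Set (PRing F) :=
  {p | ∃ (X : Struc σ) (hX : MemUpIso F X) (a b : X.carrier) (hab : a ≠ b)
    (ha : MemUpIso F (X.restrict ({a} : Set X.carrier)ᶜ))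
    (hb : MemUpIso F (X.restrict ({b} : Set X.carrier)ᶜ)),
    X ∈ F ∧ p = qElt X hX a b hab ha hb}

end Paper

namespace Paper

/-- An L-datum `((X,a),(Y,b),i)` is separated: up to isomorphism there is exactly one
amalgamation of `X` and `Y` over `X∖{a} ≅ Y∖{b}` lying in `F`, and in it the marked
points remain distinct. -/
def LSeparatedDatum (F : Set (Struc (σ := σ))) {X Y : Struc σ}
    (a : X.carrier) (b : Y.carrier)
    (i : Emb (X.restrict ({a} : Set X.carrier)ᶜ) (Y.restrict ({b} : Set Y.carrier)ᶜ)) :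
    Prop :=
  ∃ A : Amalg (X.subEmb ({a} : Set X.carrier)ᶜ)
      ((Y.subEmb ({b} : Set Y.carrier)ᶜ).comp i),
    MemUpIso F A.Z ∧ A.j₁.toFun a ≠ A.j₂.toFun b ∧
    ∀ B : Amalg (X.subEmb ({a} : Set X.carrier)ᶜ)
        ((Y.subEmb ({b} : Set Y.carrier)ᶜ).comp i),
      MemUpIso F B.Z → B.Iso A

/-- An L-datum is minimal: it is not separated, and no element of `X` is stably separated
from the marked point `a`. -/
def LMinimal (F : Set (Struc σ)) {X Y : Struc σ}
    (a : X.carrier) (b : Y.carrier)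
    (i : Emb (X.restrict ({a} : Set X.carrier)ᶜ) (Y.restrict ({b} : Set Y.carrier)ᶜ)) :
    Prop :=
  ¬ LSeparatedDatum F a b i ∧
  ∀ (c : X.carrier) (h : a ≠ c), ¬ StablySeparated F X a c h

/-- A Q-datum `(X,a,b)` is symmetric: some automorphism of `X` interchanges `a` and
`b`. -/
def QSymmetric (X : Struc σ) (a b : X.carrier) : Prop :=
  ∃ g : Emb X X, g.IsIso ∧ g.toFun a = b ∧ g.toFun b = a

/-- A Q-datum `(X,a,b)` is minimal: it is not symmetric, `a` and `b` are not separated in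
`X`, and no `c ∈ X∖{a,b}` is extraneous in all four of `(X,a)`, `(X,b)`, `(X∖{a},b)`,
`(X∖{b},a)`. -/
def QMinimal (F : Set (Struc σ)) (X : Struc σ) (a b : X.carrier) (hab : a ≠ b) : Prop :=
  ¬ QSymmetric X a b ∧ ¬ Separated F X a b hab ∧
  ∀ (c : X.carrier) (hca : c ≠ a) (hcb : c ≠ b),
    ¬ (Extraneous F X a c ∧ Extraneous F X b c ∧
       Extraneous F (X.restrict ({a} : Set X.carrier)ᶜ)
         ⟨b, Set.mem_compl_singleton_iff.mpr (Ne.symm hab)⟩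
         ⟨c, Set.mem_compl_singleton_iff.mpr hca⟩ ∧
       Extraneous F (X.restrict ({b} : Set X.carrier)ᶜ)
         ⟨a, Set.mem_compl_singleton_iff.mpr hab⟩
         ⟨c, Set.mem_compl_singleton_iff.mpr hcb⟩)

/-- The generators of the ideal `𝔟₁^min`: the elements `L(D)` over all minimal L-data. -/
def LMinSet (F : Set (Struc σ)) : Set (PRing F) :=
  {p | ∃ (X Y : Struc σ) (hX : MemUpIso F X) (hY : MemUpIso F Y)
    (a : X.carrier) (b : Y.carrier)
    (i : Emb (X.restrict ({a} : Set X.carrier)ᶜ) (Y.restrict ({b} : Set Y.carrier)ᶜ)),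
    i.IsIso ∧ LMinimal F a b i ∧ IsLElt F hX hY a b i p}

/-- The generators of the ideal `𝔟₂^min`: the elements `Q(D)` over all minimal Q-data. -/
def QMinSet (F : Set (Struc σ)) : Set (PRing F) :=
  {p | ∃ (X : Struc σ) (hX : MemUpIso F X) (a b : X.carrier) (hab : a ≠ b)
    (ha : MemUpIso F (X.restrict ({a} : Set X.carrier)ᶜ))
    (hb : MemUpIso F (X.restrict ({b} : Set X.carrier)ᶜ)),
    X ∈ F ∧ QMinimal F X a b hab ∧ p = qElt X hX a b hab ha hb}

section EmbeddingLemmas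

variable {σ : Signature}

theorem Emb.ext_toFun {X Y : Struc σ} {f g : Emb X Y} (h : ∀ x, f.toFun x = g.toFun x) :
    f = g := by
  cases f; cases g; congr; exact funext h

/-- The lift of an embedding `f` through an embedding `g` whose range contains that of `f`. -/
noncomputable def Emb.factor {X Y Z : Struc σ} (f : Emb X Z) (g : Emb Y Z)
    (h : Set.range f.toFun ⊆ Set.range g.toFun) : Emb X Y where
  toFun x := (h ⟨x, rfl⟩).choose
  inj x y hxy := f.inj <| by
    rw [← (h ⟨x, rfl⟩).choose_spec, ← (h ⟨y, rfl⟩).choose_spec]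
    exact congrArg g.toFun hxy
  rel_iff i v := by
    rw [← g.rel_iff, ← f.rel_iff]
    exact iff_of_eq (congrArg (Z.rel i) (funext fun j => (h ⟨v j, rfl⟩).choose_spec))

@[simp]
theorem Emb.factor_spec {X Y Z : Struc σ} (f : Emb X Z) (g : Emb Y Z)
    (h : Set.range f.toFun ⊆ Set.range g.toFun) (x : X.carrier) :
    g.toFun ((f.factor g h).toFun x) = f.toFun x :=
  (h ⟨x, rfl⟩).choose_spec

theorem Emb.comp_factor {X Y Z : Struc σ} (f : Emb X Z) (g : Emb Y Z)
    (h : Set.range f.toFun ⊆ Set.range g.toFun) : g.comp (f.factor g h) = f :=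
  Emb.ext_toFun (f.factor_spec g h)

theorem Emb.factor_isIso {X Y Z : Struc σ} (f : Emb X Z) (g : Emb Y Z)
    (h : Set.range f.toFun ⊆ Set.range g.toFun) (h' : Set.range g.toFun ⊆ Set.range f.toFun) :
    (f.factor g h).IsIso := by
  intro y
  obtain ⟨x, hx⟩ := h' ⟨y, rfl⟩
  exact ⟨x, g.inj (by rw [Emb.factor_spec, hx])⟩

theorem Emb.IsIso.range_eq {X Y : Struc σ} {f : Emb X Y} (hf : f.IsIso) :
    Set.range f.toFun = Set.univ := Set.range_eq_univ.2 hf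

/-- The inverse of an isomorphism. -/
noncomputable def Emb.inv {X Y : Struc σ} (f : Emb X Y) (hf : f.IsIso) : Emb Y X :=
  (Emb.id Y).factor f (by rw [hf.range_eq]; exact Set.subset_univ _)

@[simp]
theorem Emb.apply_inv {X Y : Struc σ} (f : Emb X Y) (hf : f.IsIso) (y : Y.carrier) :
    f.toFun ((f.inv hf).toFun y) = y :=
  Emb.factor_spec _ _ _ _

@[simp]
theorem Emb.inv_apply {X Y : Struc σ} (f : Emb X Y) (hf : f.IsIso) (x : X.carrier) :
    (f.inv hf).toFun (f.toFun x) = x :=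
  f.inj (f.apply_inv hf _)

theorem Emb.inv_isIso {X Y : Struc σ} (f : Emb X Y) (hf : f.IsIso) : (f.inv hf).IsIso :=
  fun x => ⟨f.toFun x, f.inv_apply hf x⟩

theorem Emb.id_isIso (X : Struc σ) : (Emb.id X).IsIso := fun x => ⟨x, rfl⟩

theorem Emb.IsIso.comp {X Y Z : Struc σ} {g : Emb Y Z} {f : Emb X Y} (hg : g.IsIso)
    (hf : f.IsIso) : (g.comp f).IsIso :=
  Function.Surjective.comp (g := g.toFun) (f := f.toFun) hg hf

@[simp]
theorem Emb.comp_apply {X Y Z : Struc σ} (g : Emb Y Z) (f : Emb X Y) (x : X.carrier) :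
    (g.comp f).toFun x = g.toFun (f.toFun x) := rfl

@[simp]
theorem Emb.id_apply {X : Struc σ} (x : X.carrier) : (Emb.id X).toFun x = x := rfl

theorem Struc.range_subEmb (X : Struc σ) (S : Set X.carrier) :
    Set.range (X.subEmb S).toFun = S :=
  Subtype.range_coe

theorem Emb.card_le {X Y : Struc σ} (f : Emb X Y) :
    Nat.card X.carrier ≤ Nat.card Y.carrier :=
  Nat.card_le_card_of_injective f.toFun f.inj

theorem IsOnePointExt.mem_range_iff {W X : Struc σ} {f : Emb W X} {a : X.carrier}
    (h : IsOnePointExt f a) {x : X.carrier} : x ∈ Set.range f.toFun ↔ x ≠ a := by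
  rw [h]; rfl

theorem IsOnePointExt.apply_ne {W X : Struc σ} {f : Emb W X} {a : X.carrier}
    (h : IsOnePointExt f a) (x : W.carrier) : f.toFun x ≠ a :=
  h.mem_range_iff.1 ⟨x, rfl⟩

theorem IsOnePointExt.exists_of_ne {W X : Struc σ} {f : Emb W X} {a : X.carrier}
    (h : IsOnePointExt f a) {x : X.carrier} (hx : x ≠ a) : ∃ w, f.toFun w = x :=
  h.mem_range_iff.2 hx

theorem isOnePointExt_of {W X : Struc σ} {f : Emb W X} {a : X.carrier}
    (h₁ : ∀ w, f.toFun w ≠ a) (h₂ : ∀ x, x ≠ a → ∃ w, f.toFun w = x) : IsOnePointExt f a :=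
  Set.Subset.antisymm (by rintro _ ⟨w, rfl⟩; exact h₁ w) (fun x hx => h₂ x hx)

theorem isOnePointExt_subEmb (X : Struc σ) (a : X.carrier) :
    IsOnePointExt (X.subEmb ({a} : Set X.carrier)ᶜ) a :=
  X.range_subEmb _

theorem IsOnePointExt.comp_isIso {V W X : Struc σ} {f : Emb W X} {a : X.carrier}
    (h : IsOnePointExt f a) {g : Emb X V} (hg : g.IsIso) :
    IsOnePointExt (g.comp f) (g.toFun a) := by
  refine isOnePointExt_of (fun w hw => h.apply_ne w (g.inj hw)) fun x hx => ?_
  obtain ⟨x, rfl⟩ := hg x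
  obtain ⟨w, rfl⟩ := h.exists_of_ne (x := x) (fun e => hx (e ▸ rfl))
  exact ⟨w, rfl⟩

theorem IsOnePointExt.card_lt {W X : Struc σ} {f : Emb W X} {a : X.carrier}
    (h : IsOnePointExt f a) : Nat.card W.carrier < Nat.card X.carrier :=
  f.card_le.lt_of_ne fun e =>
    have ⟨w, hw⟩ := (Nat.bijective_iff_injective_and_card f.toFun).2 ⟨f.inj, e⟩ |>.2 a
    h.apply_ne w hw

/-- The corestriction of an embedding to the complement of a point outside its range. -/
noncomputable def Emb.codDel {X Y : Struc σ} (f : Emb X Y) (a : Y.carrier)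
    (ha : a ∉ Set.range f.toFun) : Emb X (Y.restrict ({a} : Set Y.carrier)ᶜ) :=
  f.factor (Y.subEmb _) (by
    rw [Y.range_subEmb]
    rintro x hx rfl
    exact ha hx)

theorem Emb.comp_codDel {X Y : Struc σ} (f : Emb X Y) (a : Y.carrier)
    (ha : a ∉ Set.range f.toFun) : (Y.subEmb ({a} : Set Y.carrier)ᶜ).comp (f.codDel a ha) = f :=
  Emb.comp_factor _ _ _

@[simp]
theorem Emb.subEmb_codDel {X Y : Struc σ} (f : Emb X Y) (a : Y.carrier)
    (ha : a ∉ Set.range f.toFun) (x : X.carrier) :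
    (Y.subEmb ({a} : Set Y.carrier)ᶜ).toFun ((f.codDel a ha).toFun x) = f.toFun x :=
  Emb.factor_spec _ _ _ _

theorem MemUpIso.of_emb {F : Set (Struc σ)} (hF : IsFraisse F) {X Y : Struc σ}
    (hY : MemUpIso F Y) (f : Emb X Y) : MemUpIso F X := by
  obtain ⟨W, hW, g, -⟩ := hY
  exact hF.hereditary W hW X ⟨g.comp f⟩

theorem MemUpIso.of_iso {F : Set (Struc σ)} {X Y : Struc σ}
    (hY : MemUpIso F Y) (f : Emb X Y) (hf : f.IsIso) : MemUpIso F X := by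
  obtain ⟨W, hW, g, hg⟩ := hY
  exact ⟨W, hW, g.comp f, hg.comp hf⟩

theorem weight_eq_of_range_eq {R : Type*} {w : ∀ X : Struc σ, X.carrier → R}
    (hw : ∀ {X Y : Struc σ} (g : Emb X Y), g.IsIso → ∀ a, w X a = w Y (g.toFun a))
    {U V X : Struc σ} (p : Emb U X) (q : Emb V X)
    (h : Set.range p.toFun = Set.range q.toFun) {u : U.carrier} {v : V.carrier}
    (huv : p.toFun u = q.toFun v) : w U u = w V v := by
  rw [hw (p.factor q h.subset) (p.factor_isIso q _ h.symm.subset) u]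
  congr 1
  exact q.inj (by rw [Emb.factor_spec, huv])

end EmbeddingLemmas

section ChainProduct

variable {σ : Signature} {R : Type*} [CommRing R]

/-- The product of the weights `w` along a chain of one-point extensions of length `n`
refining an embedding. -/
noncomputable def chainProd (w : ∀ X : Struc σ, X.carrier → R) :
    ℕ → ∀ {X Y : Struc σ}, Emb X Y → R
  | 0, _, _, _ => 1
  | n + 1, _, Y, f =>
    open scoped Classical in
    if h : ∃ a, a ∉ Set.range f.toFun then
      w Y h.choose * chainProd w n (f.codDel h.choose h.choose_spec) else 1

theorem chainProd_succ (w : ∀ X : Struc σ, X.carrier → R) (n : ℕ) {X Y : Struc σ} (f : Emb X Y)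
    (h : ∃ a, a ∉ Set.range f.toFun) :
    ∃ (a : Y.carrier) (ha : a ∉ Set.range f.toFun),
      chainProd w (n + 1) f = w Y a * chainProd w n (f.codDel a ha) :=
  ⟨h.choose, h.choose_spec, by rw [chainProd, dif_pos h]⟩

/-- The number of points missed by an embedding. -/
noncomputable def Emb.codim {X Y : Struc σ} (f : Emb X Y) : ℕ := (Set.range f.toFun)ᶜ.ncard

theorem Emb.IsIso.codim_eq {X Y : Struc σ} {f : Emb X Y} (hf : f.IsIso) : f.codim = 0 := by
  simp [Emb.codim, hf.range_eq]

theorem Emb.isIso_of_codim_eq {X Y : Struc σ} {f : Emb X Y} (hf : f.codim = 0) : f.IsIso := by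
  rw [Emb.codim, Set.ncard_eq_zero, Set.compl_empty_iff] at hf
  exact Set.range_eq_univ.1 hf

theorem Emb.codim_comp_of_onePoint {X W Y : Struc σ} (f : Emb X W) {g : Emb W Y} {a : Y.carrier}
    (hg : IsOnePointExt g a) : (g.comp f).codim = f.codim + 1 := by
  have : (Set.range (g.comp f).toFun)ᶜ = insert a (g.toFun '' (Set.range f.toFun)ᶜ) := by
    ext y
    by_cases hy : y = a
    · subst hy
      simpa using fun x => hg.apply_ne _
    · obtain ⟨z, rfl⟩ := hg.exists_of_ne hy
      simp [hy, g.inj.eq_iff]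
  rw [Emb.codim, this, Set.ncard_insert_of_notMem, Set.ncard_image_of_injective _ g.inj]
  · rfl
  · rintro ⟨x, -, hx⟩
    exact hg.apply_ne _ hx

theorem Emb.codim_isIso_comp {X W Y : Struc σ} (f : Emb X W) {g : Emb W Y}
    (hg : g.IsIso) : (g.comp f).codim = f.codim := by
  have : (Set.range (g.comp f).toFun)ᶜ = g.toFun '' (Set.range f.toFun)ᶜ := by
    ext y
    obtain ⟨z, rfl⟩ := hg y
    simp [g.inj.eq_iff]
  rw [Emb.codim, this, Set.ncard_image_of_injective _ g.inj]
  rfl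

theorem Emb.exists_onePoint_factor {X Y : Struc σ} (f : Emb X Y) (hf : ¬ f.IsIso) :
    ∃ (W : Struc σ) (a : Y.carrier) (g : Emb W Y) (h : Emb X W),
      IsOnePointExt g a ∧ g.comp h = f ∧ h.codim + 1 = f.codim := by
  obtain ⟨a, ha⟩ : ∃ a, a ∉ Set.range f.toFun := by
    by_contra! h
    exact hf h
  refine ⟨_, a, _, _, isOnePointExt_subEmb Y a, f.comp_codDel a ha, ?_⟩
  rw [← Emb.codim_comp_of_onePoint _ (isOnePointExt_subEmb Y a), f.comp_codDel a ha]

/-- Weights on marked structures that are isomorphism invariant and satisfy the exchange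
relations attached to Q-data. -/
structure IsExchangeable (w : ∀ X : Struc σ, X.carrier → R) : Prop where
  iso : ∀ {X Y : Struc σ} (g : Emb X Y), g.IsIso → ∀ a, w X a = w Y (g.toFun a)
  exchange : ∀ (X : Struc σ) (a b : X.carrier) (hab : a ≠ b),
    w X a * w (X.restrict ({a} : Set X.carrier)ᶜ)
        ⟨b, Set.mem_compl_singleton_iff.mpr (Ne.symm hab)⟩ =
      w X b * w (X.restrict ({b} : Set X.carrier)ᶜ) ⟨a, Set.mem_compl_singleton_iff.mpr hab⟩

theorem chainProd_aux {w : ∀ X : Struc σ, X.carrier → R} (hw : IsExchangeable w) (n : ℕ) :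
    (∀ {X W Y : Struc σ} (f : Emb X W) (g : Emb W Y) (_ : g.IsIso), f.codim = n →
      chainProd w n (g.comp f) = chainProd w n f) ∧
    (∀ {X W Y : Struc σ} (f : Emb X W) (g : Emb W Y) (a : Y.carrier) (_ : IsOnePointExt g a),
      f.codim = n → chainProd w (n + 1) (g.comp f) = w Y a * chainProd w n f) := by
  induction n with
  | zero =>
    refine ⟨fun _ _ _ _ => rfl, fun {X W Y} f g a hg hf => ?_⟩
    have hex : ∃ b, b ∉ Set.range (g.comp f).toFun :=
      ⟨a, fun ⟨x, hx⟩ => hg.apply_ne _ hx⟩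
    obtain ⟨b, hb, e⟩ := chainProd_succ w 0 (g.comp f) hex
    have : b = a := by
      by_contra hne
      obtain ⟨z, hz⟩ := hg.exists_of_ne hne
      obtain ⟨x, rfl⟩ := Emb.isIso_of_codim_eq hf z
      exact hb ⟨x, hz⟩
    subst this
    rw [e]
    rfl
  | succ n ih =>
    obtain ⟨ih₁, ih₂⟩ := ih
    have key : ∀ {X W Y : Struc σ} (f : Emb X W) (g : Emb W Y) (_ : g.IsIso), f.codim = n + 1 →
      chainProd w (n + 1) (g.comp f) = chainProd w (n + 1) f := by
      intro X W Y f g hg hf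
      have hex : ∃ b, b ∉ Set.range f.toFun := by
        by_contra! h
        have := Emb.IsIso.codim_eq (f := f) h
        omega
      obtain ⟨b, hb, e⟩ := chainProd_succ w n f hex
      rw [e]
      conv_lhs => rw [← f.comp_codDel b hb]
      rw [hw.iso g hg]
      refine ih₂ _ (g.comp (W.subEmb _)) _ ((isOnePointExt_subEmb W b).comp_isIso hg) ?_
      rw [← f.comp_codDel b hb, Emb.codim_comp_of_onePoint _ (isOnePointExt_subEmb _ _)] at hf
      omega
    refine ⟨key, ?_⟩
    intro X W Y f g a hg hf
    have hex : ∃ b, b ∉ Set.range (g.comp f).toFun :=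
      ⟨a, fun ⟨x, hx⟩ => hg.apply_ne _ hx⟩
    obtain ⟨b, hb, e⟩ := chainProd_succ w (n + 1) (g.comp f) hex
    rw [e]
    by_cases hba : b = a
    · subst hba
      have hr : Set.range g.toFun = Set.range (Y.subEmb ({b} : Set Y.carrier)ᶜ).toFun := by
        rw [Y.range_subEmb, hg]
      congr 1
      rw [← key f (g.factor (Y.subEmb _) hr.subset) (g.factor_isIso _ _ hr.symm.subset) hf]
      congr 1
    · obtain ⟨b', rfl⟩ := hg.exists_of_ne hba
      have hb' : b' ∉ Set.range f.toFun := fun ⟨x, hx⟩ => hb ⟨x, by simp [hx]⟩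
      have hf' : (f.codDel b' hb').codim = n := by
        rw [← f.comp_codDel b' hb',
          Emb.codim_comp_of_onePoint _ (isOnePointExt_subEmb _ _)] at hf
        omega
      set V := W.restrict ({b'} : Set W.carrier)ᶜ
      have hsub : Set.range (g.comp (W.subEmb ({b'} : Set W.carrier)ᶜ)).toFun ⊆
          Set.range (Y.subEmb ({g.toFun b'} : Set Y.carrier)ᶜ).toFun := by
        rw [Y.range_subEmb]
        rintro _ ⟨x, rfl⟩ hx
        exact x.2 (g.inj hx)
      set k : Emb V (Y.restrict ({g.toFun b'} : Set Y.carrier)ᶜ) :=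
        (g.comp (W.subEmb ({b'} : Set W.carrier)ᶜ)).factor (Y.subEmb _) hsub with hk
      have hkv : ∀ v, (Y.subEmb _).toFun (k.toFun v) = g.toFun ((W.subEmb _).toFun v) :=
        fun v => Emb.factor_spec _ _ hsub v
      have hkone : IsOnePointExt k ⟨a, fun h => hba h.symm⟩ := by
        refine isOnePointExt_of (fun v h => hg.apply_ne ((W.subEmb _).toFun v) ?_) fun x hx => ?_
        · rw [← hkv, h]
          rfl
        · obtain ⟨z, hz⟩ := hg.exists_of_ne (x := x.1) (fun h => hx (Subtype.ext h))
          have hzb : z ≠ b' := by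
            rintro rfl
            exact x.2 hz.symm
          exact ⟨⟨z, hzb⟩, (Y.subEmb _).inj ((hkv _).trans hz)⟩
      have e₁ : (g.comp f).codDel (g.toFun b') hb = k.comp (f.codDel b' hb') :=
        Emb.ext_toFun fun x => (Y.subEmb _).inj (by simp [hkv])
      have e₂ := ih₂ (f.codDel b' hb') (W.subEmb _) b' (isOnePointExt_subEmb _ _) hf'
      rw [f.comp_codDel] at e₂
      rw [e₁, e₂, ih₂ _ k _ hkone hf', ← mul_assoc, ← mul_assoc,
        hw.exchange Y (g.toFun b') a hba]
      congr 2
      refine (weight_eq_of_range_eq hw.iso g (Y.subEmb _) ?_ ?_).symm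
      · rw [Y.range_subEmb, hg]
      · rfl

/-- The product of the weights along any chain of one-point extensions refining `f`. -/
noncomputable def embWeight (w : ∀ X : Struc σ, X.carrier → R) (X Y : Struc σ) (f : Emb X Y) : R :=
  chainProd w f.codim f

theorem embWeight_isIso (w : ∀ X : Struc σ, X.carrier → R) {X Y : Struc σ} {f : Emb X Y}
    (hf : f.IsIso) : embWeight w X Y f = 1 := by
  rw [embWeight, hf.codim_eq]
  rfl

theorem embWeight_onePoint_comp {w : ∀ X : Struc σ, X.carrier → R} (hw : IsExchangeable w)
    {X W Y : Struc σ} (f : Emb X W) (g : Emb W Y) {a : Y.carrier} (hg : IsOnePointExt g a) :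
    embWeight w X Y (g.comp f) = w Y a * embWeight w X W f := by
  rw [embWeight, Emb.codim_comp_of_onePoint _ hg]
  exact (chainProd_aux hw _).2 f g a hg rfl

theorem embWeight_onePoint {w : ∀ X : Struc σ, X.carrier → R} (hw : IsExchangeable w)
    {W Y : Struc σ} (g : Emb W Y) {a : Y.carrier} (hg : IsOnePointExt g a) :
    embWeight w W Y g = w Y a := by
  rw [← mul_one (w Y a), ← embWeight_isIso w (Emb.id_isIso W)]
  exact embWeight_onePoint_comp hw (Emb.id W) g hg

theorem embWeight_comp {w : ∀ X : Struc σ, X.carrier → R} (hw : IsExchangeable w)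
    {X Y Z : Struc σ} (g : Emb Y Z) (f : Emb X Y) :
    embWeight w X Z (g.comp f) = embWeight w Y Z g * embWeight w X Y f := by
  induction hn : g.codim generalizing Z with
  | zero =>
    have hg := Emb.isIso_of_codim_eq hn
    rw [embWeight_isIso w hg, one_mul, embWeight, Emb.codim_isIso_comp _ hg]
    exact (chainProd_aux hw _).1 f g hg rfl
  | succ n ih =>
    obtain ⟨W, a, p, h, hp, rfl, hc⟩ := g.exists_onePoint_factor
      (fun h => by have := h.codim_eq; omega)
    rw [embWeight_onePoint_comp hw h p hp, mul_assoc, ← ih h (by omega)]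
    exact embWeight_onePoint_comp hw (h.comp f) p hp

end ChainProduct

section Amalgamations

variable {σ : Signature} {F : Set (Struc σ)} {X Y Y' : Struc σ} {i : Emb X Y} {f : Emb X Y'}

theorem Amalg.Iso.refl (A : Amalg i f) : A.Iso A :=
  ⟨Emb.id _, Emb.id_isIso _, fun _ => rfl, fun _ => rfl⟩

theorem Amalg.Iso.symm {A B : Amalg i f} (h : A.Iso B) : B.Iso A := by
  obtain ⟨g, hg, h₁, h₂⟩ := h
  exact ⟨g.inv hg, g.inv_isIso hg, fun y => by rw [← h₁, g.inv_apply],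
    fun y => by rw [← h₂, g.inv_apply]⟩

theorem Amalg.Iso.trans {A B C : Amalg i f} (h : A.Iso B) (h' : B.Iso C) : A.Iso C := by
  obtain ⟨g, hg, h₁, h₂⟩ := h
  obtain ⟨k, hk, k₁, k₂⟩ := h'
  exact ⟨k.comp g, hk.comp hg, fun y => by rw [Emb.comp_apply, h₁, k₁],
    fun y => by rw [Emb.comp_apply, h₂, k₂]⟩

/-- To compare amalgamations it suffices to compare them inside a common structure. -/
theorem Amalg.iso_of_emb {A B : Amalg i f} {W : Struc σ} (p : Emb A.Z W) (q : Emb B.Z W)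
    (h₁ : ∀ y, p.toFun (A.j₁.toFun y) = q.toFun (B.j₁.toFun y))
    (h₂ : ∀ y, p.toFun (A.j₂.toFun y) = q.toFun (B.j₂.toFun y)) : A.Iso B := by
  have hpq : Set.range p.toFun ⊆ Set.range q.toFun := by
    rintro _ ⟨z, rfl⟩
    rcases A.surj z with ⟨y, rfl⟩ | ⟨y, rfl⟩
    · exact ⟨_, (h₁ y).symm⟩
    · exact ⟨_, (h₂ y).symm⟩
  have hqp : Set.range q.toFun ⊆ Set.range p.toFun := by
    rintro _ ⟨z, rfl⟩
    rcases B.surj z with ⟨y, rfl⟩ | ⟨y, rfl⟩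
    · exact ⟨_, h₁ y⟩
    · exact ⟨_, h₂ y⟩
  exact ⟨p.factor q hpq, p.factor_isIso q hpq hqp,
    fun y => q.inj (by rw [Emb.factor_spec, h₁]), fun y => q.inj (by rw [Emb.factor_spec, h₂])⟩

/-- Compatible embeddings into a common structure span an amalgamation. -/
theorem exists_amalg_of_emb {W : Struc σ} (p : Emb Y W) (q : Emb Y' W)
    (h : ∀ x, p.toFun (i.toFun x) = q.toFun (f.toFun x)) :
    ∃ (A : Amalg i f) (e : Emb A.Z W), (∀ y, e.toFun (A.j₁.toFun y) = p.toFun y) ∧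
      ∀ y, e.toFun (A.j₂.toFun y) = q.toFun y := by
  set S : Set W.carrier := Set.range p.toFun ∪ Set.range q.toFun
  have hp : Set.range p.toFun ⊆ Set.range (W.subEmb S).toFun := by
    rw [W.range_subEmb]; exact Set.subset_union_left
  have hq : Set.range q.toFun ⊆ Set.range (W.subEmb S).toFun := by
    rw [W.range_subEmb]; exact Set.subset_union_right
  refine ⟨⟨W.restrict S, p.factor _ hp, q.factor _ hq, fun x => (W.subEmb S).inj ?_, ?_⟩,
    W.subEmb S, fun y => Emb.factor_spec _ _ hp y, fun y => Emb.factor_spec _ _ hq y⟩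
  · rw [Emb.factor_spec, Emb.factor_spec, h]
  · rintro ⟨z, ⟨y, rfl⟩ | ⟨y, rfl⟩⟩
    · exact Or.inl ⟨y, (W.subEmb S).inj (Emb.factor_spec _ _ hp y)⟩
    · exact Or.inr ⟨y, (W.subEmb S).inj (Emb.factor_spec _ _ hq y)⟩

/-- A complete irredundant system of representatives of the amalgamations lying in `F`. -/
structure IsReps (F : Set (Struc σ)) {ι : Type*} (r : ι → Amalg i f) : Prop where
  mem : ∀ α, MemUpIso F (r α).Z
  complete : ∀ A : Amalg i f, MemUpIso F A.Z → ∃ α, A.Iso (r α)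
  irredundant : ∀ α β, (r α).Iso (r β) → α = β

theorem isReps_unit {A : Amalg i f} (hA : MemUpIso F A.Z)
    (h : ∀ B : Amalg i f, MemUpIso F B.Z → B.Iso A) : IsReps F (fun _ : Unit => A) :=
  ⟨fun _ => hA, fun B hB => ⟨(), h B hB⟩, fun _ _ _ => rfl⟩

theorem exists_isReps (hF : IsFraisse F) (i : Emb X Y) (f : Emb X Y') :
    ∃ (n : ℕ) (r : Fin n → Amalg i f), IsReps F r := by
  classical
  choose m rr hrr using hF.finClasses
  let N := Nat.card Y.carrier + Nat.card Y'.carrier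
  let Code : Type := Σ n : Fin (N + 1), Σ α : Fin (m n),
    (Y.carrier → (rr n α).carrier) × (Y'.carrier → (rr n α).carrier)
  have hcode : ∀ A : {A : Amalg i f // MemUpIso F A.Z}, ∃ c : Code,
      ∃ h : Emb A.1.Z (rr c.1 c.2.1), h.IsIso ∧ (∀ y, h.toFun (A.1.j₁.toFun y) = c.2.2.1 y) ∧
        ∀ y, h.toFun (A.1.j₂.toFun y) = c.2.2.2 y := by
    rintro ⟨A, W, hW, g, hg⟩
    have hcard : Nat.card W.carrier ≤ N := by
      have hs : Function.Surjective
          (Sum.elim (g.comp A.j₁).toFun (g.comp A.j₂).toFun) := by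
        intro w
        obtain ⟨z, rfl⟩ := hg w
        rcases A.surj z with ⟨y, rfl⟩ | ⟨y, rfl⟩
        · exact ⟨Sum.inl y, rfl⟩
        · exact ⟨Sum.inr y, rfl⟩
      have := Nat.card_le_card_of_surjective _ hs
      rwa [Nat.card_sum] at this
    obtain ⟨α, k, hk⟩ := hrr _ W hW rfl
    exact ⟨⟨⟨Nat.card W.carrier, Nat.lt_succ_of_le hcard⟩, α,
      ((k.comp g).comp A.j₁).toFun, ((k.comp g).comp A.j₂).toFun⟩, k.comp g, hk.comp hg,
      fun _ => rfl, fun _ => rfl⟩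
  choose code hcode using hcode
  let S : Setoid {A : Amalg i f // MemUpIso F A.Z} :=
    ⟨fun A B => A.1.Iso B.1, fun A => Amalg.Iso.refl A.1, Amalg.Iso.symm, Amalg.Iso.trans⟩
  have : Finite (Quotient S) := by
    refine Finite.of_injective (fun q : Quotient S => code q.out) fun q q' hqq => ?_
    obtain ⟨h, -, h₁, h₂⟩ := hcode q.out
    have hq' := hcode q'.out
    rw [← show code q.out = code q'.out from hqq] at hq'
    obtain ⟨h', -, h₁', h₂'⟩ := hq'
    refine Quotient.out_equiv_out.1 ?_
    exact Amalg.iso_of_emb h h' (fun y => by rw [h₁, h₁']) (fun y => by rw [h₂, h₂'])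
  let e := Finite.equivFin (Quotient S)
  refine ⟨_, fun α => (e.symm α).out.1, fun α => (e.symm α).out.2, fun A hA => ?_,
    fun α β h => e.symm.injective (Quotient.out_equiv_out.1 h)⟩
  refine ⟨e ⟦⟨A, hA⟩⟧, ?_⟩
  rw [e.symm_apply_apply]
  exact (Quotient.mk_out (s := S) ⟨A, hA⟩).symm

/-- Exchanging the roles of the two extensions in an amalgamation. -/
def Amalg.swap (A : Amalg i f) : Amalg f i :=
  ⟨A.Z, A.j₂, A.j₁, fun x => (A.comm x).symm, fun z => (A.surj z).symm⟩

theorem Amalg.Iso.swap {A B : Amalg i f} (h : A.Iso B) : A.swap.Iso B.swap := by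
  obtain ⟨g, hg, h₁, h₂⟩ := h
  exact ⟨g, hg, h₂, h₁⟩

theorem IsReps.swap {ι : Type*} {r : ι → Amalg i f} (h : IsReps F r) :
    IsReps F fun α => (r α).swap :=
  ⟨h.mem, fun A hA => (h.complete A.swap hA).imp fun _ h => h.swap,
    fun α β hαβ => h.irredundant α β hαβ.swap⟩

/-- Pasting of amalgamations along a factorization of the left extension. -/
def Amalg.pasteLeft {Y₁ : Struc σ} {i₁ : Emb X Y₁} {i₂ : Emb Y₁ Y} (A : Amalg i₁ f)
    (B : Amalg i₂ A.j₁) : Amalg (i₂.comp i₁) f where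
  Z := B.Z
  j₁ := B.j₁
  j₂ := B.j₂.comp A.j₂
  comm x := (B.comm _).trans (congrArg B.j₂.toFun (A.comm x))
  surj z := by
    rcases B.surj z with h | ⟨y, rfl⟩
    · exact Or.inl h
    · rcases A.surj y with ⟨w, rfl⟩ | ⟨w, rfl⟩
      · exact Or.inl ⟨_, B.comm w⟩
      · exact Or.inr ⟨w, rfl⟩

/-- Pasting of amalgamations along a factorization of the right extension. -/
def Amalg.pasteRight {Y₁ : Struc σ} {f₁ : Emb X Y₁} {f₂ : Emb Y₁ Y'} (A : Amalg i f₁)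
    (B : Amalg A.j₂ f₂) : Amalg i (f₂.comp f₁) :=
  (Amalg.pasteLeft A.swap B.swap).swap

theorem IsReps.pasteLeft {Y₁ : Struc σ} {i₁ : Emb X Y₁} {i₂ : Emb Y₁ Y} {ι : Type*}
    {κ : ι → Type*} {r : ι → Amalg i₁ f} (hF : IsFraisse F) (hr : IsReps F r)
    {s : ∀ α, κ α → Amalg i₂ (r α).j₁} (hs : ∀ α, IsReps F (s α)) :
    IsReps F fun p : Σ α, κ α => (r p.1).pasteLeft (s p.1 p.2) := by
  refine ⟨fun p => (hs p.1).mem p.2, fun A hA => ?_, ?_⟩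
  · obtain ⟨A₁, e, he₁, he₂⟩ :=
      exists_amalg_of_emb (i := i₁) (f := f) (A.j₁.comp i₂) A.j₂ A.comm
    obtain ⟨α, k, hk, hk₁, hk₂⟩ := hr.complete A₁ (hA.of_emb hF e)
    let e' := e.comp (k.inv hk)
    have he₁' : ∀ y, A.j₁.toFun (i₂.toFun y) = e'.toFun ((r α).j₁.toFun y) := fun y => by
      rw [Emb.comp_apply, ← hk₁, k.inv_apply, he₁, Emb.comp_apply]
    have he₂' : ∀ y, A.j₂.toFun y = e'.toFun ((r α).j₂.toFun y) := fun y => by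
      rw [Emb.comp_apply, ← hk₂, k.inv_apply, he₂]
    let B : Amalg i₂ (r α).j₁ := ⟨A.Z, A.j₁, e', he₁', fun z => by
      rcases A.surj z with h | ⟨y, rfl⟩
      · exact Or.inl h
      · exact Or.inr ⟨_, (he₂' y).symm⟩⟩
    obtain ⟨β, g, hg, hg₁, hg₂⟩ := (hs α).complete B hA
    refine ⟨⟨α, β⟩, g, hg, hg₁, fun y => ?_⟩
    rw [he₂']
    exact hg₂ _
  · rintro ⟨α, β⟩ ⟨α', β'⟩ ⟨k, hk, hk₁, hk₂⟩
    have hk₂ : ∀ y, k.toFun ((s α β).j₂.toFun ((r α).j₂.toFun y)) =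
      (s α' β').j₂.toFun ((r α').j₂.toFun y) := hk₂
    have hk₁ : ∀ y, k.toFun ((s α β).j₁.toFun y) = (s α' β').j₁.toFun y := hk₁
    have hk₁' : ∀ y, k.toFun ((s α β).j₂.toFun ((r α).j₁.toFun y)) =
        (s α' β').j₂.toFun ((r α').j₁.toFun y) := fun y => by
      rw [← (s α β).comm, ← (s α' β').comm, hk₁]
    obtain rfl : α = α' := hr.irredundant _ _
      (Amalg.iso_of_emb (Emb.comp k (s α β).j₂) (s α' β').j₂ hk₁' hk₂)
    obtain rfl : β = β' := by
      refine (hs α).irredundant _ _ ⟨k, hk, hk₁, fun y => ?_⟩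
      rcases (r α).surj y with ⟨y, rfl⟩ | ⟨y, rfl⟩
      · exact hk₁' y
      · exact hk₂ y
    rfl

theorem IsReps.pasteRight {Y₁ : Struc σ} {f₁ : Emb X Y₁} {f₂ : Emb Y₁ Y'} {ι : Type*}
    {κ : ι → Type*} {r : ι → Amalg i f₁} (hF : IsFraisse F) (hr : IsReps F r)
    {s : ∀ α, κ α → Amalg (r α).j₂ f₂} (hs : ∀ α, IsReps F (s α)) :
    IsReps F fun p : Σ α, κ α => (r p.1).pasteRight (s p.1 p.2) :=
  (IsReps.pasteLeft hF hr.swap (s := fun α β => (s α β).swap) fun α => (hs α).swap).swap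

section Pull

variable {X₁ Y₁ Y₁' : Struc σ} {f' : Emb X₁ Y₁'} {i' : Emb X₁ Y₁}

/-- Transport of amalgamations along an isomorphism of spans. -/
def Amalg.pull (eX : Emb X X₁) (eY : Emb Y Y₁) (eY' : Emb Y' Y₁') (hY : eY.IsIso) (hY' : eY'.IsIso)
    (h₁ : i'.comp eX = eY.comp i) (h₂ : f'.comp eX = eY'.comp f) (A : Amalg i' f') :
    Amalg i f where
  Z := A.Z
  j₁ := A.j₁.comp eY
  j₂ := A.j₂.comp eY'
  comm x := by
    change A.j₁.toFun ((eY.comp i).toFun x) = A.j₂.toFun ((eY'.comp f).toFun x)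
    rw [← h₁, ← h₂]
    exact A.comm _
  surj z := by
    rcases A.surj z with ⟨y, rfl⟩ | ⟨y, rfl⟩
    · obtain ⟨y, rfl⟩ := hY y
      exact Or.inl ⟨y, rfl⟩
    · obtain ⟨y, rfl⟩ := hY' y
      exact Or.inr ⟨y, rfl⟩

variable {eX : Emb X X₁} {eY : Emb Y Y₁} {eY' : Emb Y' Y₁'} {hY : eY.IsIso}
  {hY' : eY'.IsIso} {h₁ : i'.comp eX = eY.comp i} {h₂ : f'.comp eX = eY'.comp f}

theorem Amalg.pull_iso_pull {A B : Amalg i' f'} :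
    (A.pull eX eY eY' hY hY' h₁ h₂).Iso (B.pull eX eY eY' hY hY' h₁ h₂) ↔ A.Iso B := by
  constructor
  · rintro ⟨g, hg, g₁, g₂⟩
    refine ⟨g, hg, fun y => ?_, fun y => ?_⟩
    · obtain ⟨y, rfl⟩ := hY y
      exact g₁ y
    · obtain ⟨y, rfl⟩ := hY' y
      exact g₂ y
  · rintro ⟨g, hg, g₁, g₂⟩
    exact ⟨g, hg, fun y => g₁ _, fun y => g₂ _⟩

theorem Amalg.exists_pull_eq (hX : eX.IsIso) (A : Amalg i f) :
    ∃ B : Amalg i' f', B.Z = A.Z ∧ (B.pull eX eY eY' hY hY' h₁ h₂).Iso A := by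
  have h₁' : ∀ x, i'.toFun (eX.toFun x) = eY.toFun (i.toFun x) := fun x =>
    congrArg (fun e => Emb.toFun e x) h₁
  have h₂' : ∀ x, f'.toFun (eX.toFun x) = eY'.toFun (f.toFun x) := fun x =>
    congrArg (fun e => Emb.toFun e x) h₂
  refine ⟨A.pull (eX.inv hX) (eY.inv hY) (eY'.inv hY') (eY.inv_isIso hY) (eY'.inv_isIso hY')
    (Emb.ext_toFun fun x => ?_) (Emb.ext_toFun fun x => ?_), rfl, Emb.id _, Emb.id_isIso _,
    fun y => congrArg A.j₁.toFun (eY.inv_apply hY y),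
    fun y => congrArg A.j₂.toFun (eY'.inv_apply hY' y)⟩
  · obtain ⟨x, rfl⟩ := hX x
    rw [Emb.comp_apply, Emb.comp_apply, eX.inv_apply, h₁', eY.inv_apply]
  · obtain ⟨x, rfl⟩ := hX x
    rw [Emb.comp_apply, Emb.comp_apply, eX.inv_apply, h₂', eY'.inv_apply]

theorem IsReps.pull {ι : Type*} {r : ι → Amalg i' f'} (hr : IsReps F r) (hX : eX.IsIso) :
    IsReps F fun α => (r α).pull eX eY eY' hY hY' h₁ h₂ := by
  refine ⟨hr.mem, fun A hA => ?_, fun α β h => hr.irredundant α β (Amalg.pull_iso_pull.1 h)⟩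
  obtain ⟨B, hB, hBA⟩ := A.exists_pull_eq (hY := hY) (hY' := hY') (h₁ := h₁) (h₂ := h₂) hX
  obtain ⟨α, hα⟩ := hr.complete B (hB ▸ hA)
  exact ⟨α, hBA.symm.trans (Amalg.pull_iso_pull.2 hα)⟩

theorem Amalg.pull_unique_iff {A : Amalg i' f'} (hX : eX.IsIso) :
    (∀ B : Amalg i f, MemUpIso F B.Z → B.Iso (A.pull eX eY eY' hY hY' h₁ h₂)) ↔
      ∀ B : Amalg i' f', MemUpIso F B.Z → B.Iso A := by
  refine ⟨fun h B hB => Amalg.pull_iso_pull.1 (h (B.pull eX eY eY' hY hY' h₁ h₂) hB),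
    fun h B hB => ?_⟩
  obtain ⟨C, hC, hCB⟩ := B.exists_pull_eq (hY := hY) (hY' := hY') (h₁ := h₁) (h₂ := h₂) hX
  exact hCB.symm.trans (Amalg.pull_iso_pull.2 (h C (hC ▸ hB)))

end Pull

theorem exists_amalg (hF : IsFraisse F) (i : Emb X Y) (f : Emb X Y') (hY : MemUpIso F Y)
    (hY' : MemUpIso F Y') : ∃ A : Amalg i f, MemUpIso F A.Z := by
  obtain ⟨V, hV, d, hd⟩ := hY.of_emb hF i
  obtain ⟨W, hW, e, he⟩ := hY
  obtain ⟨W', hW', e', he'⟩ := hY'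
  obtain ⟨A, hA⟩ := hF.amalg V W W' hV hW hW' ((e.comp i).comp (d.inv hd))
    ((e'.comp f).comp (d.inv hd))
  exact ⟨A.pull d e e' he he' (Emb.ext_toFun fun x => by simp) (Emb.ext_toFun fun x => by simp), hA⟩

/-- In an amalgamation of one-point extensions whose new points stay distinct, these points
are separated exactly when the amalgamation is unique. -/
theorem separated_iff_unique (A : Amalg i f) {a : Y.carrier} {b : Y'.carrier}
    (hi : IsOnePointExt i a) (hf : IsOnePointExt f b)
    (hab : A.j₁.toFun a ≠ A.j₂.toFun b) :
    Separated F A.Z (A.j₁.toFun a) (A.j₂.toFun b) hab ↔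
      ∀ B : Amalg i f, MemUpIso F B.Z → B.Iso A := by
  have haj : ∀ y, A.j₂.toFun y ≠ A.j₁.toFun a := by
    intro y hy
    by_cases hyb : y = b
    · exact hab (hyb ▸ hy).symm
    · obtain ⟨x, rfl⟩ := hf.exists_of_ne hyb
      rw [← A.comm] at hy
      exact hi.apply_ne x (A.j₁.inj hy)
  have hbj : ∀ y, A.j₁.toFun y ≠ A.j₂.toFun b := by
    intro y hy
    by_cases hya : y = a
    · exact hab (hya ▸ hy)
    · obtain ⟨x, rfl⟩ := hi.exists_of_ne hya
      rw [A.comm] at hy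
      exact hf.apply_ne x (A.j₂.inj hy)
  have r₂ : Set.range A.j₂.toFun =
      Set.range (A.Z.subEmb ({A.j₁.toFun a} : Set A.Z.carrier)ᶜ).toFun := by
    rw [Struc.range_subEmb]
    refine Set.Subset.antisymm (by rintro _ ⟨y, rfl⟩; exact haj y) fun z hz => ?_
    rcases A.surj z with ⟨y, rfl⟩ | h
    · obtain ⟨x, rfl⟩ := hi.exists_of_ne (x := y) (fun h => hz (h ▸ rfl))
      exact ⟨_, (A.comm x).symm⟩
    · exact h
  have r₁ : Set.range A.j₁.toFun =
      Set.range (A.Z.subEmb ({A.j₂.toFun b} : Set A.Z.carrier)ᶜ).toFun := by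
    rw [Struc.range_subEmb]
    refine Set.Subset.antisymm (by rintro _ ⟨y, rfl⟩; exact hbj y) fun z hz => ?_
    rcases A.surj z with h | ⟨y, rfl⟩
    · exact h
    · obtain ⟨x, rfl⟩ := hf.exists_of_ne (x := y) (fun h => hz (h ▸ rfl))
      exact ⟨_, A.comm x⟩
  have r₀ : Set.range (A.j₁.comp i).toFun =
      Set.range (A.Z.subEmb ({A.j₁.toFun a, A.j₂.toFun b} : Set A.Z.carrier)ᶜ).toFun := by
    rw [Struc.range_subEmb]
    refine Set.Subset.antisymm ?_ fun z hz => ?_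
    · rintro _ ⟨x, rfl⟩ (h | h)
      · exact hi.apply_ne x (A.j₁.inj h)
      · exact hbj _ h
    · obtain ⟨y, rfl⟩ : z ∈ Set.range A.j₁.toFun := by
        rw [r₁, Struc.range_subEmb]
        exact fun h => hz (Or.inr h)
      obtain ⟨x, rfl⟩ := hi.exists_of_ne (x := y) (fun h => hz (Or.inl (h ▸ rfl)))
      exact ⟨x, rfl⟩
  let eX := (A.j₁.comp i).factor _ r₀.subset
  let eY := A.j₁.factor _ r₁.subset
  let eY' := A.j₂.factor _ r₂.subset
  have hX : eX.IsIso := Emb.factor_isIso _ _ _ r₀.symm.subset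
  have hY : eY.IsIso := Emb.factor_isIso _ _ _ r₁.symm.subset
  have hY' : eY'.IsIso := Emb.factor_isIso _ _ _ r₂.symm.subset
  have heX : ∀ x, (A.Z.subEmb _).toFun (eX.toFun x) = A.j₁.toFun (i.toFun x) :=
    Emb.factor_spec _ _ r₀.subset
  have heY : ∀ x, (A.Z.subEmb _).toFun (eY.toFun x) = A.j₁.toFun x :=
    Emb.factor_spec _ _ r₁.subset
  have heY' : ∀ x, (A.Z.subEmb _).toFun (eY'.toFun x) = A.j₂.toFun x :=
    Emb.factor_spec _ _ r₂.subset
  have h₁ : (A.Z.inclEmb (pair_compl_subset_left _ _)).comp eX = eY'.comp f :=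
    Emb.ext_toFun fun x => (A.Z.subEmb _).inj
      ((heX x).trans ((A.comm x).trans (heY' _).symm))
  have h₂ : (A.Z.inclEmb (pair_compl_subset_right _ _)).comp eX = eY.comp i :=
    Emb.ext_toFun fun x => (A.Z.subEmb _).inj ((heX x).trans (heY _).symm)
  have hA : ((canonAmalg A.Z _ _ hab).pull eX eY' eY hY' hY h₁ h₂).Iso A.swap :=
    ⟨Emb.id _, Emb.id_isIso _, heY', heY⟩
  rw [Separated, ← Amalg.pull_unique_iff (eX := eX) (eY := eY') (eY' := eY) (hY := hY')
    (hY' := hY) (h₁ := h₁) (h₂ := h₂) hX]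
  exact ⟨fun h B hB => ((h B.swap hB).trans hA).swap,
    fun h B hB => (h B.swap hB).swap.trans hA.symm⟩

theorem Separated.symm {a b : X.carrier} {hab : a ≠ b} (h : Separated F X a b hab) :
    Separated F X b a hab.symm := by
  have hl : IsOnePointExt (X.inclEmb (pair_compl_subset_left a b)) ⟨b, hab.symm⟩ :=
    isOnePointExt_of (fun w hw => w.2 (Or.inr (congrArg Subtype.val hw))) fun x hx =>
      ⟨⟨x.1, fun h => h.elim x.2 fun h => hx (Subtype.ext h)⟩, rfl⟩
  have hr : IsOnePointExt (X.inclEmb (pair_compl_subset_right a b)) ⟨a, hab⟩ :=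
    isOnePointExt_of (fun w hw => w.2 (Or.inl (congrArg Subtype.val hw))) fun x hx =>
      ⟨⟨x.1, fun h => h.elim (fun h => hx (Subtype.ext h)) x.2⟩, rfl⟩
  exact (separated_iff_unique (canonAmalg X a b hab) hl hr hab.symm).2 h

theorem Amalg.j₂_isIso_or_onePoint (A : Amalg i f) {a : Y.carrier} (hi : IsOnePointExt i a) :
    A.j₂.IsIso ∨ IsOnePointExt A.j₂ (A.j₁.toFun a) := by
  by_cases h : A.j₁.toFun a ∈ Set.range A.j₂.toFun
  · left
    intro z
    rcases A.surj z with ⟨y, rfl⟩ | h'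
    · by_cases hy : y = a
      · exact hy ▸ h
      · obtain ⟨x, rfl⟩ := hi.exists_of_ne hy
        exact ⟨_, (A.comm x).symm⟩
    · exact h'
  · right
    refine isOnePointExt_of (fun y hy => h ⟨y, hy⟩) fun z hz => ?_
    rcases A.surj z with ⟨y, rfl⟩ | h'
    · obtain ⟨x, rfl⟩ := hi.exists_of_ne (x := y) (fun h => hz (h ▸ rfl))
      exact ⟨_, (A.comm x).symm⟩
    · exact h'

theorem Amalg.j₂_isIso_of_eq (A : Amalg i f) {a : Y.carrier} (hi : IsOnePointExt i a)
    {y : Y'.carrier} (h : A.j₁.toFun a = A.j₂.toFun y) : A.j₂.IsIso :=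
  (A.j₂_isIso_or_onePoint hi).resolve_right fun h' => h'.apply_ne y h.symm

theorem Amalg.j₂_onePoint_of_ne (A : Amalg i f) {a : Y.carrier} (hi : IsOnePointExt i a)
    {b : Y'.carrier} (hf : IsOnePointExt f b) (h : A.j₁.toFun a ≠ A.j₂.toFun b) :
    IsOnePointExt A.j₂ (A.j₁.toFun a) := by
  refine (A.j₂_isIso_or_onePoint hi).resolve_left fun h' => ?_
  obtain ⟨y, hy⟩ := h' (A.j₁.toFun a)
  obtain ⟨x, rfl⟩ := hf.exists_of_ne (x := y) (by rintro rfl; exact h hy.symm)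
  rw [← A.comm] at hy
  exact hi.apply_ne x (A.j₁.inj hy)

end Amalgamations

section AmalgRelation

variable {σ : Signature} {F : Set (Struc σ)} {R : Type*} [CommRing R]
  {G : ∀ X Y : Struc σ, Emb X Y → R}

/-- `G` sends isomorphisms to `1` and is multiplicative for composition. -/
structure IsMultiplicative (F : Set (Struc σ)) (G : ∀ X Y : Struc σ, Emb X Y → R) : Prop where
  iso : ∀ {X Y : Struc σ} (f : Emb X Y), MemUpIso F Y → f.IsIso → G X Y f = 1
  comp : ∀ {X Y Z : Struc σ} (g : Emb Y Z) (f : Emb X Y), MemUpIso F Z →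
    G X Z (g.comp f) = G Y Z g * G X Y f

/-- The amalgamation relation for `G` at a pair of embeddings with common source. -/
def AmalgRel (F : Set (Struc σ)) (G : ∀ X Y : Struc σ, Emb X Y → R) {X Y Y' : Struc σ}
    (i : Emb X Y) (f : Emb X Y') : Prop :=
  ∀ (ι : Type) [Fintype ι] (r : ι → Amalg i f), IsReps F r →
    G X Y i = ∑ α, G Y' (r α).Z (r α).j₂

theorem IsMultiplicative.isIso_comp (hG : IsMultiplicative F G) {X Y Z : Struc σ} {g : Emb Y Z}
    (hg : g.IsIso) (hZ : MemUpIso F Z) (f : Emb X Y) : G X Z (g.comp f) = G X Y f := by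
  rw [hG.comp g f hZ, hG.iso g hZ hg, one_mul]

theorem IsMultiplicative.comp_isIso (hG : IsMultiplicative F G) {X Y Z : Struc σ} (g : Emb Y Z)
    {f : Emb X Y} (hf : f.IsIso) (hZ : MemUpIso F Z) (hY : MemUpIso F Y) :
    G X Z (g.comp f) = G Y Z g := by
  rw [hG.comp g f hZ, hG.iso f hY hf, mul_one]

variable {X Y Y' : Struc σ} {i : Emb X Y} {f : Emb X Y'}

theorem AmalgRel.of_isReps (hG : IsMultiplicative F G) {κ : Type*} [Fintype κ]
    {s : κ → Amalg i f} (hs : IsReps F s) (h : G X Y i = ∑ α, G Y' (s α).Z (s α).j₂) :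
    AmalgRel F G i f := by
  intro ι _ r hr
  rw [h]
  choose e he using fun α => hr.complete (s α) (hs.mem α)
  refine Fintype.sum_bijective e ⟨fun α β hαβ => hs.irredundant _ _ ?_, fun β => ?_⟩ _ _ fun α => ?_
  · exact (he α).trans (hαβ ▸ (he β).symm)
  · obtain ⟨α, hα⟩ := hs.complete (r β) (hr.mem β)
    exact ⟨α, (hr.irredundant _ _ (hα.trans (he α))).symm⟩
  · obtain ⟨g, hg, -, h₂⟩ := he α
    rw [← hG.isIso_comp hg (hr.mem _)]
    congr 1
    exact Emb.ext_toFun h₂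

theorem AmalgRel.of_unique (hG : IsMultiplicative F G) {A : Amalg i f} (hA : MemUpIso F A.Z)
    (hu : ∀ B : Amalg i f, MemUpIso F B.Z → B.Iso A) (h : G X Y i = G Y' A.Z A.j₂) :
    AmalgRel F G i f :=
  AmalgRel.of_isReps hG (isReps_unit hA hu) (by simpa using h)

theorem AmalgRel.of_isIso_left (hG : IsMultiplicative F G) (hi : i.IsIso) (hY : MemUpIso F Y)
    (hY' : MemUpIso F Y') : AmalgRel F G i f := by
  refine AmalgRel.of_unique hG (A := ⟨Y', f.comp (i.inv hi), Emb.id Y', fun x => by simp,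
    fun z => Or.inr ⟨z, rfl⟩⟩) hY' (fun B hB => Amalg.Iso.symm ⟨B.j₂, fun z => ?_, fun y => ?_,
    fun _ => rfl⟩) ?_
  · rcases B.surj z with ⟨y, rfl⟩ | h
    · obtain ⟨x, rfl⟩ := hi y
      exact ⟨_, (B.comm x).symm⟩
    · exact h
  · obtain ⟨x, rfl⟩ := hi y
    rw [Emb.comp_apply, i.inv_apply, B.comm]
  · rw [hG.iso i hY hi, hG.iso _ hY' (Emb.id_isIso Y')]

theorem AmalgRel.of_isIso_right (hG : IsMultiplicative F G) (hf : f.IsIso) (hY : MemUpIso F Y)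
    (hX : MemUpIso F X) : AmalgRel F G i f := by
  refine AmalgRel.of_unique hG (A := ⟨Y, Emb.id Y, i.comp (f.inv hf), fun x => by simp,
    fun z => Or.inl ⟨z, rfl⟩⟩) hY (fun B hB => Amalg.Iso.symm ⟨B.j₁, fun z => ?_, fun _ => rfl,
    fun y => ?_⟩) ?_
  · rcases B.surj z with h | ⟨y, rfl⟩
    · exact h
    · obtain ⟨x, rfl⟩ := hf y
      exact ⟨_, B.comm x⟩
  · obtain ⟨x, rfl⟩ := hf y
    rw [Emb.comp_apply, f.inv_apply, B.comm]
  · exact (hG.comp_isIso i (f.inv_isIso hf) hY hX).symm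

theorem AmalgRel.comp_left (hF : IsFraisse F) (hG : IsMultiplicative F G) {Y₁ : Struc σ}
    {i₁ : Emb X Y₁} {i₂ : Emb Y₁ Y} (hY : MemUpIso F Y) (h₁ : AmalgRel F G i₁ f)
    (h₂ : ∀ A : Amalg i₁ f, MemUpIso F A.Z → AmalgRel F G i₂ A.j₁) :
    AmalgRel F G (i₂.comp i₁) f := by
  obtain ⟨n, r, hr⟩ := exists_isReps hF i₁ f
  choose m s hs using fun α => exists_isReps hF i₂ (r α).j₁
  refine AmalgRel.of_isReps hG (IsReps.pasteLeft hF hr hs) ?_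
  rw [hG.comp _ _ hY, h₁ _ r hr, Finset.mul_sum, Fintype.sum_sigma]
  refine Finset.sum_congr rfl fun α _ => ?_
  rw [h₂ _ (hr.mem α) _ (s α) (hs α), Finset.sum_mul]
  exact Finset.sum_congr rfl fun β _ => (hG.comp _ _ ((hs α).mem β)).symm

theorem AmalgRel.comp_right (hF : IsFraisse F) (hG : IsMultiplicative F G) {Y₁ : Struc σ}
    {f₁ : Emb X Y₁} {f₂ : Emb Y₁ Y'} (h₁ : AmalgRel F G i f₁)
    (h₂ : ∀ A : Amalg i f₁, MemUpIso F A.Z → AmalgRel F G A.j₂ f₂) :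
    AmalgRel F G i (f₂.comp f₁) := by
  obtain ⟨n, r, hr⟩ := exists_isReps hF i f₁
  choose m s hs using fun α => exists_isReps hF (r α).j₂ f₂
  refine AmalgRel.of_isReps hG (IsReps.pasteRight hF hr hs) ?_
  rw [h₁ _ r hr, Fintype.sum_sigma]
  exact Finset.sum_congr rfl fun α _ => h₂ _ (hr.mem α) _ (s α) (hs α)

theorem AmalgRel.pull (hF : IsFraisse F) (hG : IsMultiplicative F G) {X' Y₁ Y₁' : Struc σ}
    {i' : Emb X' Y₁} {f' : Emb X' Y₁'} {eX : Emb X X'} {eY : Emb Y Y₁} {eY' : Emb Y' Y₁'}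
    (hX : eX.IsIso) (hY : eY.IsIso) (hY' : eY'.IsIso) (h₁ : i'.comp eX = eY.comp i)
    (h₂ : f'.comp eX = eY'.comp f) (hU : MemUpIso F Y₁) (hV : MemUpIso F Y₁')
    (h : AmalgRel F G i' f') : AmalgRel F G i f := by
  obtain ⟨n, r, hr⟩ := exists_isReps hF i' f'
  refine AmalgRel.of_isReps hG
    (hr.pull (hY := hY) (hY' := hY') (h₁ := h₁) (h₂ := h₂) hX) ?_
  rw [← hG.isIso_comp hY hU, ← h₁, hG.comp_isIso i' hX hU (hU.of_emb hF i'), h _ r hr]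
  exact Finset.sum_congr rfl fun α _ => (hG.comp_isIso _ hY' (hr.mem α) hV).symm

/-- The amalgamation relations follow from those for pairs of one-point extensions. -/
theorem AmalgRel.of_onePoint (hF : IsFraisse F) (hG : IsMultiplicative F G)
    (h : ∀ {X Y Y' : Struc σ} (i : Emb X Y) (f : Emb X Y') (a : Y.carrier) (b : Y'.carrier),
      MemUpIso F Y → MemUpIso F Y' → IsOnePointExt i a → IsOnePointExt f b → AmalgRel F G i f)
    {X Y Y' : Struc σ} (i : Emb X Y) (f : Emb X Y') (hY : MemUpIso F Y) (hY' : MemUpIso F Y') :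
    AmalgRel F G i f := by
  have key : ∀ (n : ℕ) {X Y Y' : Struc σ} (i : Emb X Y) (f : Emb X Y') (a : Y.carrier),
      MemUpIso F Y → MemUpIso F Y' → IsOnePointExt i a → f.codim = n → AmalgRel F G i f := by
    intro n
    induction n with
    | zero =>
      intro X Y Y' i f a hY hY' _ hf
      exact .of_isIso_right hG (Emb.isIso_of_codim_eq hf) hY (hY.of_emb hF i)
    | succ n ih =>
      intro X Y Y' i f a hY hY' hi hf
      obtain ⟨W, b, f₂, f₁, hf₂, rfl, hc⟩ := f.exists_onePoint_factor
        (fun h => by have := h.codim_eq; omega)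
      refine .comp_right hF hG (ih i f₁ a hY (hY'.of_emb hF f₂) hi (by omega)) fun A hA => ?_
      rcases A.j₂_isIso_or_onePoint hi with h' | h'
      · exact .of_isIso_left hG h' hA hY'
      · exact h _ _ _ _ hA hY' h' hf₂
  induction hn : i.codim generalizing Y with
  | zero => exact .of_isIso_left hG (Emb.isIso_of_codim_eq hn) hY hY'
  | succ n ih =>
    obtain ⟨W, a, i₂, i₁, hi₂, rfl, hc⟩ := i.exists_onePoint_factor
      (fun h => by have := h.codim_eq; omega)
    exact .comp_left hF hG hY (ih i₁ (hY.of_emb hF i₂) (by omega))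
      fun A hA => key _ _ _ a hY hA hi₂ rfl

end AmalgRelation

section OnePointAmalgamations

variable {σ : Signature} {F : Set (Struc σ)}

theorem IsMultiplicative.onePoint_eq {R : Type*} [CommRing R]
    {G : ∀ X Y : Struc σ, Emb X Y → R} (hF : IsFraisse F)
    (hG : IsMultiplicative F G) {V W X : Struc σ}
    {f : Emb W X} {g : Emb V X} {a : X.carrier} (hX : MemUpIso F X) (hf : IsOnePointExt f a)
    (hg : IsOnePointExt g a) : G W X f = G V X g := by
  have h : Set.range f.toFun = Set.range g.toFun := by rw [hf, hg]
  conv_lhs => rw [← f.comp_factor g h.subset]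
  exact hG.comp_isIso g (f.factor_isIso g _ h.symm.subset) hX (hX.of_emb hF g)

theorem Amalg.iso_of_identified {X Y Y' : Struc σ} {i : Emb X Y} {f : Emb X Y'} {a : Y.carrier}
    {b : Y'.carrier} (hi : IsOnePointExt i a) {A B : Amalg i f}
    (hA : A.j₁.toFun a = A.j₂.toFun b) (hB : B.j₁.toFun a = B.j₂.toFun b) : A.Iso B := by
  refine Amalg.iso_of_emb (B.j₂.comp (A.j₂.inv (A.j₂_isIso_of_eq hi hA))) (Emb.id _)
    (fun y => ?_) (fun y => by simp)
  by_cases hy : y = a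
  · rw [hy, hA, Emb.comp_apply, Emb.inv_apply, Emb.id_apply, hB]
  · obtain ⟨x, rfl⟩ := hi.exists_of_ne hy
    rw [A.comm, Emb.comp_apply, Emb.inv_apply, Emb.id_apply, B.comm]

theorem LExtends.apply_eq {X Y : Struc σ} {a : X.carrier} {b : Y.carrier}
    {i : Emb (X.restrict ({a} : Set X.carrier)ᶜ) (Y.restrict ({b} : Set Y.carrier)ᶜ)}
    (hi : i.IsIso) {g : Emb X Y}
    (hg : ∀ w : (X.restrict ({a} : Set X.carrier)ᶜ).carrier, g.toFun w.1 = (i.toFun w).1) :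
    g.toFun a = b := by
  by_contra h
  obtain ⟨w, hw⟩ := hi ⟨g.toFun a, h⟩
  exact w.2 (g.inj ((hg w).trans (congrArg Subtype.val hw)))

theorem isOnePointExt_subEmb_comp {X Y : Struc σ} {b : Y.carrier}
    {i : Emb X (Y.restrict ({b} : Set Y.carrier)ᶜ)} (hi : i.IsIso) :
    IsOnePointExt ((Y.subEmb ({b} : Set Y.carrier)ᶜ).comp i) b := by
  refine isOnePointExt_of (fun w => (i.toFun w).2) fun y hy => ?_
  obtain ⟨w, hw⟩ := hi ⟨y, hy⟩
  exact ⟨w, congrArg Subtype.val hw⟩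

open scoped Classical in
/-- A system of representatives of the amalgamations of an L-datum in which the marked points
remain distinct completes to a full system, with one further member exactly when the L-datum
extends. -/
theorem exists_isReps_of_distinct {X Y : Struc σ} {a : X.carrier} {b : Y.carrier}
    {i : Emb (X.restrict ({a} : Set X.carrier)ᶜ) (Y.restrict ({b} : Set Y.carrier)ᶜ)}
    (hi : i.IsIso) (hY : MemUpIso F Y) {m : ℕ}
    (r : Fin m → Amalg (X.subEmb ({a} : Set X.carrier)ᶜ)
      ((Y.subEmb ({b} : Set Y.carrier)ᶜ).comp i))
    (hr : ∀ α, MemUpIso F (r α).Z)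
    (hne : ∀ α, (r α).j₁.toFun a ≠ (r α).j₂.toFun b)
    (hc : ∀ A : Amalg (X.subEmb ({a} : Set X.carrier)ᶜ)
        ((Y.subEmb ({b} : Set Y.carrier)ᶜ).comp i),
      MemUpIso F A.Z → A.j₁.toFun a ≠ A.j₂.toFun b → ∃ α, A.Iso (r α))
    (hirr : ∀ α β, (r α).Iso (r β) → α = β) :
    ∃ (ι : Type) (_ : Fintype ι) (s : ι → Amalg (X.subEmb ({a} : Set X.carrier)ᶜ)
        ((Y.subEmb ({b} : Set Y.carrier)ᶜ).comp i)), IsReps F s ∧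
      ∀ {R : Type 1} [CommRing R] (G : ∀ X Y : Struc σ, Emb X Y → R), IsMultiplicative F G →
        ∑ α, G Y (s α).Z (s α).j₂ =
          (if LExtends i then 1 else 0) + ∑ α, G Y (r α).Z (r α).j₂ := by
  have hX1 := isOnePointExt_subEmb X a
  by_cases hext : LExtends i
  · obtain ⟨g, hg, hgi⟩ := id hext
    have hga := LExtends.apply_eq hi hgi
    let E : Amalg (X.subEmb ({a} : Set X.carrier)ᶜ) ((Y.subEmb ({b} : Set Y.carrier)ᶜ).comp i) :=
      ⟨Y, g, Emb.id Y, hgi, fun z => Or.inr ⟨z, rfl⟩⟩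
    have hE : E.j₁.toFun a = E.j₂.toFun b := hga
    have hEr : ∀ α, ¬ E.Iso (r α) := by
      rintro α ⟨k, -, k₁, k₂⟩
      exact hne α (by rw [← k₁, ← k₂, hE])
    refine ⟨Option (Fin m), inferInstance, fun o => o.elim E r, ⟨?_, fun A hA => ?_, ?_⟩, ?_⟩
    · rintro (_ | α)
      · exact hY
      · exact hr α
    · by_cases h : A.j₁.toFun a = A.j₂.toFun b
      · exact ⟨none, Amalg.iso_of_identified hX1 h hE⟩
      · obtain ⟨α, hα⟩ := hc A hA h
        exact ⟨some α, hα⟩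
    · rintro (_ | α) (_ | β) h
      · rfl
      · exact (hEr β h).elim
      · exact (hEr α h.symm).elim
      · rw [hirr α β h]
    · intro R _ G hG
      rw [Fintype.sum_option, if_pos hext]
      congr 1
      exact hG.iso _ hY (Emb.id_isIso Y)
  · refine ⟨Fin m, inferInstance, r, ⟨hr, fun A hA => hc A hA fun h => hext ?_, hirr⟩, ?_⟩
    · have h₂ := A.j₂_isIso_of_eq hX1 h
      have h₁ : A.j₁.IsIso := A.swap.j₂_isIso_of_eq (isOnePointExt_subEmb_comp hi) h.symm
      refine ⟨(A.j₂.inv h₂).comp A.j₁, (A.j₂.inv_isIso h₂).comp h₁, fun w => A.j₂.inj ?_⟩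
      rw [Emb.comp_apply, Emb.apply_inv]
      exact A.comm w
    · intro R _ G _
      rw [if_neg hext, zero_add]

end OnePointAmalgamations

section MinimalRelations

variable {σ : Signature} {F : Set (Struc σ)}

/-- The ideal generated by `𝔟₀`, `𝔟₁^min` and `𝔟₂^min`. -/
noncomputable abbrev minIdeal (F : Set (Struc σ)) : Ideal (PRing F) :=
  Ideal.span (B0Set F) + Ideal.span (LMinSet F) + Ideal.span (QMinSet F)

theorem b0Set_subset_minIdeal {p : PRing F} (h : p ∈ B0Set F) : p ∈ minIdeal F :=
  (le_sup_left.trans le_sup_left : Ideal.span (B0Set F) ≤ minIdeal F) (Ideal.subset_span h)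

theorem lMinSet_subset_minIdeal {p : PRing F} (h : p ∈ LMinSet F) : p ∈ minIdeal F :=
  (le_sup_right.trans le_sup_left : Ideal.span (LMinSet F) ≤ minIdeal F) (Ideal.subset_span h)

theorem qMinSet_subset_minIdeal {p : PRing F} (h : p ∈ QMinSet F) : p ∈ minIdeal F :=
  (le_sup_right : Ideal.span (QMinSet F) ≤ minIdeal F) (Ideal.subset_span h)

open scoped Classical in
/-- The class of `⟦X,a⟧` modulo `minIdeal F`, extended by zero outside `F`. -/
noncomputable def markedClass (F : Set (Struc σ)) (X : Struc σ) (a : X.carrier) :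
    PRing F ⧸ minIdeal F :=
  if h : MemUpIso F X then Ideal.Quotient.mk _ (mVar X h a) else 0

theorem markedClass_of_mem {X : Struc σ} (h : MemUpIso F X) (a : X.carrier) :
    markedClass F X a = Ideal.Quotient.mk _ (mVar X h a) :=
  dif_pos h

theorem markedClass_iso {X Y : Struc σ} (g : Emb X Y) (hg : g.IsIso) (a : X.carrier) :
    markedClass F X a = markedClass F Y (g.toFun a) := by
  by_cases hY : MemUpIso F Y
  · have hX := hY.of_iso g hg
    rw [markedClass_of_mem hX, markedClass_of_mem hY]
    exact congrArg _ (congrArg MvPolynomial.X (Quot.sound ⟨g, hg, rfl⟩))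
  · have hX : ¬ MemUpIso F X := fun h => hY (h.of_iso (g.inv hg) (g.inv_isIso hg))
    rw [markedClass, markedClass, dif_neg hX, dif_neg hY]

theorem markedClass_of_separated (hF : IsFraisse F) {X : Struc σ} (hX : MemUpIso F X)
    {a b : X.carrier} {hab : a ≠ b} (h : Separated F X a b hab) :
    markedClass F X a = markedClass F (X.restrict ({b} : Set X.carrier)ᶜ)
      ⟨a, Set.mem_compl_singleton_iff.mpr hab⟩ := by
  have hb := memUpIso_restrict hF hX ({b} : Set X.carrier)ᶜ
  refine (markedClass_of_mem hX a).trans (Eq.trans ?_ (markedClass_of_mem hb _).symm)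
  rw [← sub_eq_zero, ← map_sub, Ideal.Quotient.eq_zero_iff_mem]
  exact b0Set_subset_minIdeal ⟨X, hX, a, b, hab, h, hb, rfl⟩

theorem markedClass_del_iso {X W : Struc σ} (g : Emb X W) (hg : g.IsIso) {a b : X.carrier}
    {hab : b ∈ ({a} : Set X.carrier)ᶜ}
    {hab' : g.toFun b ∈ ({g.toFun a} : Set W.carrier)ᶜ} :
    markedClass F (X.restrict ({a} : Set X.carrier)ᶜ) ⟨b, hab⟩ =
      markedClass F (W.restrict ({g.toFun a} : Set W.carrier)ᶜ) ⟨g.toFun b, hab'⟩ :=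
  weight_eq_of_range_eq markedClass_iso (g.comp (X.subEmb _)) (W.subEmb _)
    (by rw [(isOnePointExt_subEmb X a).comp_isIso hg, W.range_subEmb]) rfl

theorem range_del_del {X : Struc σ} {a c : X.carrier} (hc : c ∈ ({a} : Set X.carrier)ᶜ) :
    Set.range ((X.subEmb ({a} : Set X.carrier)ᶜ).comp (Struc.subEmb _
      ({⟨c, hc⟩} : Set (X.restrict ({a} : Set X.carrier)ᶜ).carrier)ᶜ)).toFun =
      ({a, c} : Set X.carrier)ᶜ := by
  refine Set.Subset.antisymm ?_ fun x hx => ?_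
  · rintro _ ⟨w, rfl⟩ (h | h)
    · exact w.1.2 h
    · exact w.2 (Subtype.ext h)
  · exact ⟨⟨⟨x, fun h => hx (Or.inl h)⟩, fun h => hx (Or.inr (congrArg Subtype.val h))⟩, rfl⟩

theorem markedClass_del_del {X : Struc σ} {a b c : X.carrier} (hca : c ≠ a) (hba : b ≠ a)
    (hbc : b ≠ c) :
    markedClass F (Struc.restrict (X.restrict ({a} : Set X.carrier)ᶜ) ({⟨c, hca⟩} : Set _)ᶜ)
        ⟨⟨b, hba⟩, fun h => hbc (congrArg Subtype.val h)⟩ =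
      markedClass F (Struc.restrict (X.restrict ({c} : Set X.carrier)ᶜ) ({⟨a, hca.symm⟩} : Set _)ᶜ)
        ⟨⟨b, hbc⟩, fun h => hba (congrArg Subtype.val h)⟩ :=
  weight_eq_of_range_eq markedClass_iso ((X.subEmb _).comp (Struc.subEmb _ _))
    ((X.subEmb _).comp (Struc.subEmb _ _))
    ((range_del_del hca).trans ((congrArg _ (Set.pair_comm a c)).trans
      (range_del_del hca.symm).symm)) rfl

theorem markedClass_exchange (hF : IsFraisse F) (X : Struc σ) (a b : X.carrier) (hab : a ≠ b) :
    markedClass F X a * markedClass F (X.restrict ({a} : Set X.carrier)ᶜ)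
        ⟨b, Set.mem_compl_singleton_iff.mpr (Ne.symm hab)⟩ =
      markedClass F X b * markedClass F (X.restrict ({b} : Set X.carrier)ᶜ)
        ⟨a, Set.mem_compl_singleton_iff.mpr hab⟩ := by
  induction hn : Nat.card X.carrier using Nat.strong_induction_on generalizing X with
  | _ n ih =>
  by_cases hX : MemUpIso F X
  swap
  · simp only [markedClass, dif_neg hX, zero_mul]
  obtain ⟨W, hWF, g, hg⟩ := hX
  have hW := memUpIso_of_mem hWF
  have hgab : g.toFun a ≠ g.toFun b := fun h => hab (g.inj h)
  rw [markedClass_iso g hg a, markedClass_iso g hg b,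
    markedClass_del_iso g hg (hab' := Set.mem_compl_singleton_iff.mpr (Ne.symm hgab)),
    markedClass_del_iso g hg (hab' := Set.mem_compl_singleton_iff.mpr hgab)]
  have hn' : Nat.card W.carrier ≤ n := hn ▸ Emb.card_le (g.inv hg)
  generalize g.toFun a = a at *
  generalize g.toFun b = b at *
  by_cases hsym : QSymmetric W a b
  · obtain ⟨s, hs, hsa, hsb⟩ := hsym
    subst hsa
    rw [← markedClass_iso s hs a]
    congr 1
    have := markedClass_del_iso (F := F) s hs (a := a) (b := s.toFun a)
      (hab := Ne.symm hgab) (hab' := by rw [hsb]; exact hgab)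
    rw [this]
    congr 1
    exact Subtype.ext hsb
  by_cases hsep : Separated F W a b hgab
  · rw [markedClass_of_separated hF hW hsep, markedClass_of_separated hF hW hsep.symm, mul_comm]
  have ha := memUpIso_restrict hF hW ({a} : Set W.carrier)ᶜ
  have hb := memUpIso_restrict hF hW ({b} : Set W.carrier)ᶜ
  by_cases hmin : QMinimal F W a b hgab
  · have := qMinSet_subset_minIdeal ⟨W, hW, a, b, hgab, ha, hb, hWF, hmin, rfl⟩
    rw [← Ideal.Quotient.eq_zero_iff_mem, qElt, map_sub, map_mul, map_mul, sub_eq_zero] at this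
    have ha' := markedClass_of_mem ha ⟨b, hgab.symm⟩
    have hb' := markedClass_of_mem hb ⟨a, hgab⟩
    rw [markedClass_of_mem hW, markedClass_of_mem hW]
    exact (congrArg (_ * ·) ha').trans (this.trans (congrArg (_ * ·) hb').symm)
  · have hex := fun h => hmin ⟨hsym, hsep, h⟩
    simp only [imp_false, not_forall, not_not] at hex
    obtain ⟨c, hca, hcb, ⟨h₁, h₁'⟩, ⟨h₂, h₂'⟩, ⟨h₃, h₃'⟩, ⟨h₄, h₄'⟩⟩ := hex
    rw [markedClass_of_separated hF hW h₁', markedClass_of_separated hF hW h₂',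
      markedClass_of_separated hF ha h₃', markedClass_of_separated hF hb h₄',
      markedClass_del_del hca hgab.symm hcb.symm, markedClass_del_del hcb hgab hca.symm]
    exact ih _ ((isOnePointExt_subEmb W c).card_lt.trans_le hn')
      (W.restrict ({c} : Set W.carrier)ᶜ) ⟨a, hca.symm⟩ ⟨b, hcb.symm⟩
      (fun h => hgab (congrArg Subtype.val h)) rfl

theorem isExchangeable_markedClass (hF : IsFraisse F) : IsExchangeable (markedClass F) :=
  ⟨markedClass_iso, markedClass_exchange hF⟩

theorem isMultiplicative_embWeight (hF : IsFraisse F) :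
    IsMultiplicative F (embWeight (markedClass F)) :=
  ⟨fun _ _ hf => embWeight_isIso _ hf,
    fun g f _ => embWeight_comp (isExchangeable_markedClass hF) g f⟩

variable {X Y Y' : Struc σ} {i : Emb X Y} {f : Emb X Y'} {a : Y.carrier} {b : Y'.carrier}

theorem amalgRel_of_unique_of_ne (hF : IsFraisse F) (hi : IsOnePointExt i a)
    (hf : IsOnePointExt f b) {A : Amalg i f} (hA : MemUpIso F A.Z)
    (hab : A.j₁.toFun a ≠ A.j₂.toFun b) (hu : ∀ B : Amalg i f, MemUpIso F B.Z → B.Iso A) :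
    AmalgRel F (embWeight (markedClass F)) i f := by
  have hw := isExchangeable_markedClass hF
  refine .of_unique (isMultiplicative_embWeight hF) hA hu ?_
  rw [embWeight_onePoint hw i hi, embWeight_onePoint hw _ (A.j₂_onePoint_of_ne hi hf hab),
    markedClass_of_separated hF hA ((separated_iff_unique A hi hf hab).2 hu)]
  have hr : IsOnePointExt A.j₁ (A.j₂.toFun b) := A.swap.j₂_onePoint_of_ne hf hi hab.symm
  exact weight_eq_of_range_eq markedClass_iso A.j₁ (Struc.subEmb _ _)
    (by rw [hr, Struc.range_subEmb]) rfl

theorem exists_onePoint_restrict (hi : IsOnePointExt i a) (c : X.carrier) :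
    ∃ K : Emb (X.restrict ({c} : Set X.carrier)ᶜ) (Y.restrict ({i.toFun c} : Set Y.carrier)ᶜ),
      (∀ x, (Y.subEmb _).toFun (K.toFun x) = i.toFun ((X.subEmb _).toFun x)) ∧
      IsOnePointExt K ⟨a, (hi.apply_ne c).symm⟩ := by
  have h : Set.range (i.comp (X.subEmb ({c} : Set X.carrier)ᶜ)).toFun ⊆
      Set.range (Y.subEmb ({i.toFun c} : Set Y.carrier)ᶜ).toFun := by
    rw [Y.range_subEmb]
    rintro _ ⟨x, rfl⟩ hx
    exact x.2 (i.inj hx)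
  have hK := Emb.factor_spec _ _ h
  refine ⟨Emb.factor _ _ h, hK,
    isOnePointExt_of (fun w hw => hi.apply_ne ((X.subEmb _).toFun w) ?_) fun y hy => ?_⟩
  · exact (hK w).symm.trans (congrArg (Y.subEmb _).toFun hw)
  · obtain ⟨x, hx⟩ := hi.exists_of_ne (x := y.1) fun h => hy (Subtype.ext h)
    have hxc : x ≠ c := by
      rintro rfl
      exact y.2 hx.symm
    exact ⟨⟨x, hxc⟩, (Y.subEmb _).inj ((hK _).trans hx)⟩

/-- Removing a stably separated point reduces the amalgamation relation to smaller structures. -/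
theorem amalgRel_of_stablySeparated (hF : IsFraisse F) (hY : MemUpIso F Y)
    (hY' : MemUpIso F Y') (hi : IsOnePointExt i a) (hf : IsOnePointExt f b)
    (ih : ∀ {X₁ Y₁ Y₁' : Struc σ} (i₁ : Emb X₁ Y₁) (f₁ : Emb X₁ Y₁') (a₁ : Y₁.carrier)
      (b₁ : Y₁'.carrier), Nat.card Y₁.carrier < Nat.card Y.carrier → MemUpIso F Y₁ →
      MemUpIso F Y₁' → IsOnePointExt i₁ a₁ → IsOnePointExt f₁ b₁ →
      AmalgRel F (embWeight (markedClass F)) i₁ f₁)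
    {c : Y.carrier} {hac : a ≠ c} (hc : StablySeparated F Y a c hac) :
    AmalgRel F (embWeight (markedClass F)) i f := by
  have hG := isMultiplicative_embWeight hF
  obtain ⟨c, rfl⟩ := hi.exists_of_ne hac.symm
  obtain ⟨K, hK, hK1⟩ := exists_onePoint_restrict hi c
  obtain ⟨f₁, hf₁, hf₁1⟩ := exists_onePoint_restrict hf c
  have hg1 := isOnePointExt_subEmb X c
  have hg'1 := isOnePointExt_subEmb Y' (f.toFun c)
  let A₀ : Amalg K (X.subEmb ({c} : Set X.carrier)ᶜ) := ⟨Y, Y.subEmb _, i, hK, fun z => by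
    by_cases hz : z = i.toFun c
    · exact Or.inr ⟨c, hz.symm⟩
    · exact Or.inl ⟨⟨z, hz⟩, rfl⟩⟩
  have hu : ∀ B : Amalg K (X.subEmb ({c} : Set X.carrier)ᶜ), MemUpIso F B.Z → B.Iso A₀ :=
    (separated_iff_unique A₀ hK1 hg1 hac).1 (hc Y hY (Emb.id Y))
  have hKg : AmalgRel F (embWeight (markedClass F)) K (X.subEmb ({c} : Set X.carrier)ᶜ) :=
    amalgRel_of_unique_of_ne hF hK1 hg1 hY hac hu
  have hcomp : (Y'.subEmb ({f.toFun c} : Set Y'.carrier)ᶜ).comp f₁ =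
      f.comp (X.subEmb ({c} : Set X.carrier)ᶜ) := Emb.ext_toFun hf₁
  have hrel : AmalgRel F (embWeight (markedClass F)) K
      (f.comp (X.subEmb ({c} : Set X.carrier)ᶜ)) := by
    rw [← hcomp]
    refine .comp_right hF hG (ih K f₁ _ _ (isOnePointExt_subEmb Y _).card_lt
      (memUpIso_restrict hF hY _) (memUpIso_restrict hF hY' _) hK1 hf₁1) fun A hA => ?_
    rcases A.j₂_isIso_or_onePoint hK1 with h | h
    · exact .of_isIso_left hG h hA hY'
    · obtain ⟨W, hW⟩ := exists_amalg hF A.j₂ (Y'.subEmb ({f.toFun c} : Set Y'.carrier)ᶜ) hA hY'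
      obtain ⟨B, e, he₁, he₂⟩ := exists_amalg_of_emb (i := K)
        (f := X.subEmb ({c} : Set X.carrier)ᶜ) (W.j₁.comp A.j₁) (W.j₂.comp f) fun x => by
          rw [Emb.comp_apply, Emb.comp_apply, A.comm, W.comm, hf₁]
      obtain ⟨k, hk, hk₁, hk₂⟩ := (hu B (hW.of_emb hF e)).symm
      have hst := hc W.Z hW (e.comp k)
      have ea : (e.comp k).toFun a = W.j₁.toFun (A.j₁.toFun ⟨a, (hi.apply_ne c).symm⟩) :=
        (congrArg e.toFun (hk₁ ⟨a, (hi.apply_ne c).symm⟩)).trans (he₁ _)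
      have ec : (e.comp k).toFun (i.toFun c) = W.j₂.toFun (f.toFun c) :=
        (congrArg e.toFun (hk₂ c)).trans (he₂ c)
      simp only [ea, ec] at hst
      have hne : W.j₁.toFun (A.j₁.toFun ⟨a, (hi.apply_ne c).symm⟩) ≠ W.j₂.toFun (f.toFun c) := by
        rw [← ea, ← ec]
        exact fun h => hac ((e.comp k).inj h)
      exact amalgRel_of_unique_of_ne hF h hg'1 hW hne
        ((separated_iff_unique W h hg'1 hne).1 hst)
  intro ι _ r hr
  have hKi : embWeight (markedClass F) _ _ K = embWeight (markedClass F) _ _ i := by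
    simpa using hKg Unit _ (isReps_unit (A := A₀) hY hu)
  rw [← hKi, hrel _ _ (IsReps.pasteRight hF (isReps_unit (A := A₀) hY hu) (s := fun _ => r)
    fun _ => hr), Fintype.sum_sigma, Fintype.sum_unique]
  rfl

theorem amalgRel_of_lMinimal (hF : IsFraisse F) (hY : MemUpIso F Y)
    (hY' : MemUpIso F Y')
    {i : Emb (Y.restrict ({a} : Set Y.carrier)ᶜ) (Y'.restrict ({b} : Set Y'.carrier)ᶜ)}
    (hi : i.IsIso) (hmin : LMinimal F a b i) :
    AmalgRel F (embWeight (markedClass F)) (Y.subEmb ({a} : Set Y.carrier)ᶜ)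
      ((Y'.subEmb ({b} : Set Y'.carrier)ᶜ).comp i) := by
  classical
  have hG := isMultiplicative_embWeight hF
  have hw := isExchangeable_markedClass hF
  have hY1 := isOnePointExt_subEmb Y a
  have hf1 := isOnePointExt_subEmb_comp hi
  obtain ⟨n, s, hs⟩ := exists_isReps hF (Y.subEmb ({a} : Set Y.carrier)ᶜ)
    ((Y'.subEmb ({b} : Set Y'.carrier)ᶜ).comp i)
  let e := (Fintype.equivFin {α // (s α).j₁.toFun a ≠ (s α).j₂.toFun b}).symm
  let r := fun β => s (e β).1
  have hr : ∀ α, MemUpIso F (r α).Z := fun α => hs.mem _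
  have hne : ∀ α, (r α).j₁.toFun a ≠ (r α).j₂.toFun b := fun α => (e α).2
  have hc : ∀ A : Amalg (Y.subEmb ({a} : Set Y.carrier)ᶜ)
        ((Y'.subEmb ({b} : Set Y'.carrier)ᶜ).comp i),
      MemUpIso F A.Z → A.j₁.toFun a ≠ A.j₂.toFun b → ∃ α, A.Iso (r α) := by
    intro A hA hab
    obtain ⟨α, hα⟩ := hs.complete A hA
    have hα' : (s α).j₁.toFun a ≠ (s α).j₂.toFun b := by
      obtain ⟨k, -, k₁, k₂⟩ := hα
      rw [← k₁, ← k₂]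
      exact fun h => hab (k.inj h)
    refine ⟨e.symm ⟨α, hα'⟩, ?_⟩
    simpa only [r, Equiv.apply_symm_apply] using hα
  have hirr : ∀ α β, (r α).Iso (r β) → α = β := fun α β h =>
    e.injective (Subtype.ext (hs.irredundant _ _ h))
  obtain ⟨ι, _, t, ht, hsum⟩ := exists_isReps_of_distinct hi hY' r hr hne hc hirr
  refine .of_isReps hG ht ?_
  rw [hsum _ hG, embWeight_onePoint hw _ hY1, markedClass_of_mem hY]
  have hmem := lMinSet_subset_minIdeal
    ⟨Y, Y', hY, hY', a, b, i, hi, hmin, _, r, hr, hne, hc, hirr, rfl⟩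
  rw [← Ideal.Quotient.eq_zero_iff_mem, sub_sub, map_sub, sub_eq_zero, map_add, map_sum] at hmem
  rw [hmem, apply_ite (Ideal.Quotient.mk _), map_one, map_zero]
  congr 1
  refine Finset.sum_congr rfl fun α _ => ?_
  rw [embWeight_onePoint hw _ ((r α).j₂_onePoint_of_ne hY1 hf1 (hne α)), markedClass_of_mem]

theorem amalgRel_of_onePoint (hF : IsFraisse F) (i : Emb X Y) (f : Emb X Y') (a : Y.carrier)
    (b : Y'.carrier) (hY : MemUpIso F Y) (hY' : MemUpIso F Y') (hi : IsOnePointExt i a)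
    (hf : IsOnePointExt f b) : AmalgRel F (embWeight (markedClass F)) i f := by
  induction hn : Nat.card Y.carrier using Nat.strong_induction_on generalizing X Y Y' with
  | _ n ih =>
  have hG := isMultiplicative_embWeight hF
  have hu : (i.codDel a fun ⟨x, hx⟩ => hi.apply_ne x hx).IsIso :=
    Emb.factor_isIso _ _ _ (by rw [hi, Y.range_subEmb])
  have hv : (f.codDel b fun ⟨x, hx⟩ => hf.apply_ne x hx).IsIso :=
    Emb.factor_isIso _ _ _ (by rw [hf, Y'.range_subEmb])
  refine .pull hF hG (i' := Y.subEmb ({a} : Set Y.carrier)ᶜ)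
    (f' := (Y'.subEmb ({b} : Set Y'.carrier)ᶜ).comp
      ((f.codDel b fun ⟨x, hx⟩ => hf.apply_ne x hx).comp (Emb.inv _ hu)))
    (eY := Emb.id Y) (eY' := Emb.id Y') hu (Emb.id_isIso _) (Emb.id_isIso _)
    (Emb.ext_toFun fun x => by simp) (Emb.ext_toFun fun x => by simp) hY hY' ?_
  have hiso := hv.comp (Emb.inv_isIso _ hu)
  generalize (f.codDel b fun ⟨x, hx⟩ => hf.apply_ne x hx).comp (Emb.inv _ hu) = j at hiso
  have hY1 := isOnePointExt_subEmb Y a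
  have hf1 := isOnePointExt_subEmb_comp hiso
  by_cases hsep : LSeparatedDatum F a b j
  · obtain ⟨A, hA, hab, hu⟩ := hsep
    exact amalgRel_of_unique_of_ne hF hY1 hf1 hA hab hu
  by_cases hst : ∃ (c : Y.carrier) (h : a ≠ c), StablySeparated F Y a c h
  · obtain ⟨c, h, hc⟩ := hst
    exact amalgRel_of_stablySeparated hF hY hY' hY1 hf1
      (fun i₁ f₁ a₁ b₁ hlt h₁ h₂ h₃ h₄ => ih _ (hn ▸ hlt) i₁ f₁ a₁ b₁ h₁ h₂ h₃ h₄ rfl) hc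
  · push Not at hst
    exact amalgRel_of_lMinimal hF hY hY' hiso ⟨hsep, hst⟩

end MinimalRelations

section ThetaFunction

variable {σ : Signature} {F : Set (Struc σ)}

theorem thetaClass_isIso {X Y : Struc σ} (hX : X ∈ F) (hY : Y ∈ F) {f : Emb X Y} (hf : f.IsIso) :
    thetaClass X Y hX hY f = 1 := by
  rw [← sub_eq_zero]
  exact Ideal.Quotient.eq_zero_iff_mem.2
    (Ideal.subset_span (Or.inl (Or.inl ⟨X, Y, hX, hY, f, hf, rfl⟩)))

theorem thetaClass_comp {X Y Z : Struc σ} (hX : X ∈ F) (hY : Y ∈ F) (hZ : Z ∈ F) (f : Emb X Y)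
    (g : Emb Y Z) :
    thetaClass X Z hX hZ (g.comp f) = thetaClass Y Z hY hZ g * thetaClass X Y hX hY f := by
  rw [← sub_eq_zero]
  exact Ideal.Quotient.eq_zero_iff_mem.2
    (Ideal.subset_span (Or.inl (Or.inr ⟨X, Y, Z, hX, hY, hZ, f, g, rfl⟩)))

theorem thetaClass_conj {X Y V W V₀ W₀ : Struc σ} (hV₀ : V₀ ∈ F) (hW₀ : W₀ ∈ F) (hV : V ∈ F)
    (hW : W ∈ F) {f : Emb X Y} {d₀ : Emb X V₀} {e₀ : Emb Y W₀} (hd₀ : d₀.IsIso) (he₀ : e₀.IsIso)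
    {d : Emb X V} {e : Emb Y W} (hd : d.IsIso) (he : e.IsIso) {g : Emb V W}
    (h : g.comp d = e.comp f) :
    thetaClass V₀ W₀ hV₀ hW₀ ((e₀.comp f).comp (d₀.inv hd₀)) = thetaClass V W hV hW g := by
  have e₁ : g = ((e.comp (e₀.inv he₀)).comp ((e₀.comp f).comp (d₀.inv hd₀))).comp
      (d₀.comp (d.inv hd)) := by
    refine Emb.ext_toFun fun v => ?_
    obtain ⟨x, rfl⟩ := hd v
    simpa using congrArg (fun k => Emb.toFun k x) h
  rw [e₁, thetaClass_comp hV hV₀ hW,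
    thetaClass_comp hV₀ hW₀ hW,
    thetaClass_isIso _ _ (he.comp (e₀.inv_isIso he₀)),
    thetaClass_isIso _ _ (hd₀.comp (d.inv_isIso hd)), one_mul, mul_one]

open scoped Classical in
/-- The class in `Θ(𝔉)` of an embedding between structures lying in `F` up to isomorphism. -/
noncomputable def thetaFun (F : Set (Struc σ)) (X Y : Struc σ) (f : Emb X Y) : ThetaRing F :=
  if h : MemUpIso F X ∧ MemUpIso F Y then
    thetaClass h.1.choose h.2.choose h.1.choose_spec.1 h.2.choose_spec.1
      ((h.2.choose_spec.2.choose.comp f).comp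
        (h.1.choose_spec.2.choose.inv h.1.choose_spec.2.choose_spec))
  else 0

theorem thetaFun_eq {X Y V W : Struc σ} (hV : V ∈ F) (hW : W ∈ F) {f : Emb X Y} {d : Emb X V}
    {e : Emb Y W} (hd : d.IsIso) (he : e.IsIso) {g : Emb V W} (h : g.comp d = e.comp f) :
    thetaFun F X Y f = thetaClass V W hV hW g := by
  have H : MemUpIso F X ∧ MemUpIso F Y := ⟨⟨V, hV, d, hd⟩, ⟨W, hW, e, he⟩⟩
  rw [thetaFun, dif_pos H]
  exact thetaClass_conj H.1.choose_spec.1 H.2.choose_spec.1 hV hW H.1.choose_spec.2.choose_spec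
    H.2.choose_spec.2.choose_spec hd he h

theorem thetaFun_of_mem {X Y : Struc σ} (hX : X ∈ F) (hY : Y ∈ F) (f : Emb X Y) :
    thetaFun F X Y f = thetaClass X Y hX hY f :=
  thetaFun_eq hX hY (Emb.id_isIso X) (Emb.id_isIso Y) rfl

theorem isMultiplicative_thetaFun (hF : IsFraisse F) : IsMultiplicative F (thetaFun F) := by
  refine ⟨fun {X Y} f hY hf => ?_, fun {X Y Z} g f hZ => ?_⟩
  · obtain ⟨W, hW, e, he⟩ := hY
    rw [thetaFun_eq hW hW (he.comp hf) he (g := Emb.id W) rfl,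
      thetaClass_isIso _ _ (Emb.id_isIso W)]
  · obtain ⟨V, hV, d, hd⟩ := hZ.of_emb hF (g.comp f)
    obtain ⟨W, hW, e, he⟩ := hZ.of_emb hF g
    obtain ⟨U, hU, k, hk⟩ := hZ
    have h₁ : ((e.comp f).comp (d.inv hd)).comp d = e.comp f := Emb.ext_toFun fun x => by simp
    have h₂ : ((k.comp g).comp (e.inv he)).comp e = k.comp g := Emb.ext_toFun fun x => by simp
    rw [thetaFun_eq hV hW hd he h₁, thetaFun_eq hW hU he hk h₂, ← thetaClass_comp]
    exact thetaFun_eq hV hU hd hk (Emb.ext_toFun fun x => by simp)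

theorem amalgRel_thetaFun (hF : IsFraisse F) {X Y Y' : Struc σ} (i : Emb X Y) (f : Emb X Y')
    (hY : MemUpIso F Y) (hY' : MemUpIso F Y') : AmalgRel F (thetaFun F) i f := by
  have hG := isMultiplicative_thetaFun hF
  obtain ⟨V, hV, d, hd⟩ := hY.of_emb hF i
  obtain ⟨W, hW, e, he⟩ := hY
  obtain ⟨W', hW', e', he'⟩ := hY'
  refine .pull hF hG (i' := (e.comp i).comp (d.inv hd)) (f' := (e'.comp f).comp (d.inv hd)) hd he
    he' (Emb.ext_toFun fun x => by simp) (Emb.ext_toFun fun x => by simp) (memUpIso_of_mem hW)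
    (memUpIso_of_mem hW') ?_
  generalize (e.comp i).comp (d.inv hd) = i
  generalize (e'.comp f).comp (d.inv hd) = f
  obtain ⟨n, r, hr⟩ := exists_isReps hF i f
  choose U hU k hk using hr.mem
  let s : Fin n → Amalg i f := fun α => ⟨U α, (k α).comp (r α).j₁, (k α).comp (r α).j₂,
    fun x => congrArg (k α).toFun ((r α).comm x), fun z => by
      obtain ⟨z, rfl⟩ := hk α z
      rcases (r α).surj z with ⟨y, rfl⟩ | ⟨y, rfl⟩
      · exact Or.inl ⟨y, rfl⟩
      · exact Or.inr ⟨y, rfl⟩⟩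
  have hrs : ∀ α, (r α).Iso (s α) := fun α => ⟨k α, hk α, fun _ => rfl, fun _ => rfl⟩
  have hs : IsReps F s := ⟨fun α => memUpIso_of_mem (hU α),
    fun A hA => (hr.complete A hA).imp fun α h => h.trans (hrs α),
    fun α β h => hr.irredundant _ _ ((hrs α).trans (h.trans (hrs β).symm))⟩
  refine .of_isReps hG hs ?_
  rw [thetaFun_of_mem hV hW, ← sub_eq_zero]
  have := Ideal.Quotient.eq_zero_iff_mem.2 (Ideal.subset_span (s := ThetaRels F)
    (Or.inr ⟨V, W, W', hV, hW, hW', i, f, n, s, hU, hs.complete, hs.irredundant, rfl⟩))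
  rw [map_sub, map_sum] at this
  rw [← this]
  congr 1
  exact Finset.sum_congr rfl fun α _ => thetaFun_of_mem hW' (hU α) _

end ThetaFunction

section Comparison

variable {σ : Signature} {F : Set (Struc σ)}

/-- The ring homomorphism `P → Θ(𝔉)` given by `⟦X,a⟧ ↦ [X,a]`. -/
noncomputable def pringToTheta (hF : IsFraisse F) : PRing F →+* ThetaRing F :=
  (MvPolynomial.aeval (Quot.lift
    (fun p : MarkedIn F => thetaFun F _ p.1.1 (p.1.1.subEmb ({p.2} : Set p.1.1.carrier)ᶜ)) (by
      rintro ⟨⟨X, hX⟩, a⟩ ⟨⟨Y, hY⟩, b⟩ ⟨g, hg, hgb⟩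
      have hG := isMultiplicative_thetaFun hF
      dsimp only at g hg hgb ⊢
      subst hgb
      rw [← hG.isIso_comp hg hY]
      exact hG.onePoint_eq hF hY ((isOnePointExt_subEmb X a).comp_isIso hg)
        (isOnePointExt_subEmb Y _)))).toRingHom

theorem pringToTheta_mVar (hF : IsFraisse F) {W X : Struc σ} (hX : MemUpIso F X) {a : X.carrier}
    {g : Emb W X} (hg : IsOnePointExt g a) :
    pringToTheta hF (mVar X hX a) = thetaFun F W X g := by
  refine (MvPolynomial.aeval_X _ _).trans ?_
  exact (isMultiplicative_thetaFun hF).onePoint_eq hF hX (isOnePointExt_subEmb X a) hg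

theorem minIdeal_le_ker (hF : IsFraisse F) : minIdeal F ≤ RingHom.ker (pringToTheta hF) := by
  classical
  have hG := isMultiplicative_thetaFun hF
  refine sup_le (sup_le ?_ ?_) ?_ <;> rw [Ideal.span_le]
  · rintro _ ⟨X, hX, a, b, hab, hsep, hb, rfl⟩
    rw [SetLike.mem_coe, RingHom.mem_ker, map_sub, sub_eq_zero]
    have hr : IsOnePointExt (X.inclEmb (pair_compl_subset_right a b)) ⟨a, hab⟩ :=
      isOnePointExt_of (fun w hw => w.2 (Or.inl (congrArg Subtype.val hw))) fun x hx =>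
        ⟨⟨x.1, fun h => h.elim (fun h => hx (Subtype.ext h)) x.2⟩, rfl⟩
    rw [pringToTheta_mVar hF hX (isOnePointExt_subEmb X a), pringToTheta_mVar hF hb hr]
    have := amalgRel_thetaFun hF (X.inclEmb (pair_compl_subset_right a b))
      (X.inclEmb (pair_compl_subset_left a b)) hb (memUpIso_restrict hF hX _) Unit _
      (isReps_unit (A := (canonAmalg X a b hab).swap) hX fun B hB => (hsep B.swap hB).swap)
    rw [this, Fintype.sum_unique]
    rfl
  · rintro _ ⟨X, Y, hX, hY, a, b, i, hi, -, m, r, hr, hne, hc, hirr, rfl⟩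
    have hX1 := isOnePointExt_subEmb X a
    obtain ⟨ι, _, t, ht, hsum⟩ := exists_isReps_of_distinct hi hY r hr hne hc hirr
    rw [SetLike.mem_coe, RingHom.mem_ker, sub_sub, map_sub, sub_eq_zero, map_add, map_sum,
      apply_ite (pringToTheta hF), map_one, map_zero, pringToTheta_mVar hF hX hX1,
      amalgRel_thetaFun hF _ _ hX hY ι t ht, hsum _ hG]
    congr 1
    exact Finset.sum_congr rfl fun α _ => (pringToTheta_mVar hF _
      ((r α).j₂_onePoint_of_ne hX1 (isOnePointExt_subEmb_comp hi) (hne α))).symm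
  · rintro _ ⟨X, hX, a, b, hab, ha, hb, -, -, rfl⟩
    have hl : IsOnePointExt (X.inclEmb (pair_compl_subset_left a b)) ⟨b, hab.symm⟩ :=
      isOnePointExt_of (fun w hw => w.2 (Or.inr (congrArg Subtype.val hw))) fun x hx =>
        ⟨⟨x.1, fun h => h.elim x.2 fun h => hx (Subtype.ext h)⟩, rfl⟩
    have hr : IsOnePointExt (X.inclEmb (pair_compl_subset_right a b)) ⟨a, hab⟩ :=
      isOnePointExt_of (fun w hw => w.2 (Or.inl (congrArg Subtype.val hw))) fun x hx =>
        ⟨⟨x.1, fun h => h.elim (fun h => hx (Subtype.ext h)) x.2⟩, rfl⟩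
    rw [SetLike.mem_coe, RingHom.mem_ker, qElt, map_sub, map_mul, map_mul, sub_eq_zero,
      pringToTheta_mVar hF hX (isOnePointExt_subEmb X a),
      pringToTheta_mVar hF hX (isOnePointExt_subEmb X b), pringToTheta_mVar hF ha hl,
      pringToTheta_mVar hF hb hr, ← hG.comp _ _ hX, ← hG.comp _ _ hX]
    rfl

/-- The ring homomorphism induced by `pringToTheta` on the quotient by `minIdeal F`. -/
noncomputable def quotientToTheta (hF : IsFraisse F) : PRing F ⧸ minIdeal F →+* ThetaRing F :=
  Ideal.Quotient.lift _ (pringToTheta hF) fun _ h => minIdeal_le_ker hF h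

theorem quotientToTheta_markedClass (hF : IsFraisse F) {W X : Struc σ} (hX : MemUpIso F X)
    {a : X.carrier} {g : Emb W X} (hg : IsOnePointExt g a) :
    quotientToTheta hF (markedClass F X a) = thetaFun F W X g := by
  rw [markedClass_of_mem hX, ← pringToTheta_mVar hF hX hg]
  exact Ideal.Quotient.lift_mk _ _ _

theorem quotientToTheta_embWeight (hF : IsFraisse F) {X Y : Struc σ} (hY : MemUpIso F Y)
    (f : Emb X Y) : quotientToTheta hF (embWeight (markedClass F) X Y f) = thetaFun F X Y f := by
  have hG := isMultiplicative_thetaFun hF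
  induction hn : f.codim generalizing Y with
  | zero =>
    have hf := Emb.isIso_of_codim_eq hn
    rw [embWeight_isIso _ hf, hG.iso f hY hf, map_one]
  | succ n ih =>
    obtain ⟨W, a, g, h, hg, rfl, hc⟩ := f.exists_onePoint_factor
      (fun h => by have := h.codim_eq; omega)
    rw [embWeight_onePoint_comp (isExchangeable_markedClass hF) h g hg, map_mul,
      quotientToTheta_markedClass hF hY hg, ih (hY.of_emb hF g) h (by omega), hG.comp g h hY]

/-- The ring homomorphism on the polynomial ring presenting `Θ(𝔉)` sending an embedding to the
product of the marked classes along a chain of one-point extensions. -/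
noncomputable def thetaPolyToQuotient (F : Set (Struc σ)) :
    ThetaPoly F →+* PRing F ⧸ minIdeal F :=
  (MvPolynomial.aeval fun p : ThetaGen F =>
    embWeight (markedClass F) p.1.1 p.2.1.1 p.2.2).toRingHom

theorem thetaPolyToQuotient_thetaVar {X Y : Struc σ} (hX : X ∈ F) (hY : Y ∈ F) (f : Emb X Y) :
    thetaPolyToQuotient F (thetaVar X Y hX hY f) = embWeight (markedClass F) X Y f :=
  MvPolynomial.aeval_X _ _

theorem thetaRels_le_ker (hF : IsFraisse F) :
    Ideal.span (ThetaRels F) ≤ RingHom.ker (thetaPolyToQuotient F) := by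
  have hG := isMultiplicative_embWeight hF
  rw [Ideal.span_le]
  rintro _ ((⟨X, Y, hX, hY, f, hf, rfl⟩ | ⟨X, Y, Z, hX, hY, hZ, f, g, rfl⟩) |
    ⟨X, Y, X', hX, hY, hX', i, f, m, r, hr, hc, hirr, rfl⟩) <;>
    rw [SetLike.mem_coe, RingHom.mem_ker, map_sub, sub_eq_zero, thetaPolyToQuotient_thetaVar]
  · rw [map_one, embWeight_isIso _ hf]
  · rw [map_mul, thetaPolyToQuotient_thetaVar, thetaPolyToQuotient_thetaVar,
      hG.comp _ _ (memUpIso_of_mem hZ)]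
  · rw [map_sum, AmalgRel.of_onePoint hF hG (amalgRel_of_onePoint hF) i f (memUpIso_of_mem hY)
      (memUpIso_of_mem hX') _ r ⟨fun α => memUpIso_of_mem (hr α), hc, hirr⟩]
    exact Finset.sum_congr rfl fun α _ => (thetaPolyToQuotient_thetaVar _ _ _).symm

/-- The inverse of `quotientToTheta`. -/
noncomputable def thetaToQuotient (hF : IsFraisse F) : ThetaRing F →+* PRing F ⧸ minIdeal F :=
  Ideal.Quotient.lift _ (thetaPolyToQuotient F) fun _ h => thetaRels_le_ker hF h

theorem thetaToQuotient_thetaFun (hF : IsFraisse F) {X Y : Struc σ} (hY : MemUpIso F Y)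
    (f : Emb X Y) :
    thetaToQuotient hF (thetaFun F X Y f) = embWeight (markedClass F) X Y f := by
  have hG := isMultiplicative_embWeight hF
  obtain ⟨V, hV, d, hd⟩ := hY.of_emb hF f
  obtain ⟨W, hW, e, he⟩ := hY
  have hW' := memUpIso_of_mem hW
  have h : ((e.comp f).comp (d.inv hd)).comp d = e.comp f := Emb.ext_toFun fun x => by simp
  have hf : embWeight (markedClass F) X Y f =
      embWeight (markedClass F) V W ((e.comp f).comp (d.inv hd)) :=
    (hG.isIso_comp he hW' f).symm.trans
      ((congrArg _ h.symm).trans (hG.comp_isIso _ hd hW' (memUpIso_of_mem hV)))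
  rw [thetaFun_eq hV hW hd he h, hf]
  exact (Ideal.Quotient.lift_mk _ _ _).trans (thetaPolyToQuotient_thetaVar _ _ _)

/-- The isomorphism between `P` modulo the minimal relations and `Θ(𝔉)`. -/
noncomputable def quotientEquivTheta (hF : IsFraisse F) : PRing F ⧸ minIdeal F ≃+* ThetaRing F :=
  RingEquiv.ofRingHom (quotientToTheta hF) (thetaToQuotient hF)
    (by
      refine Ideal.Quotient.ringHom_ext (MvPolynomial.ringHom_ext (fun n => by simp) ?_)
      rintro ⟨⟨X, hX⟩, ⟨Y, hY⟩, f⟩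
      have hY' := memUpIso_of_mem hY
      change quotientToTheta hF (thetaToQuotient hF (thetaClass X Y hX hY f)) =
        thetaClass X Y hX hY f
      rw [← thetaFun_of_mem hX hY, thetaToQuotient_thetaFun hF hY',
        quotientToTheta_embWeight hF hY'])
    (by
      refine Ideal.Quotient.ringHom_ext (MvPolynomial.ringHom_ext (fun n => by simp) ?_)
      rintro ⟨⟨X, hX⟩, a⟩
      change thetaToQuotient hF (quotientToTheta hF (Ideal.Quotient.mk _ (mVar X hX a))) =
        Ideal.Quotient.mk _ (mVar X hX a)
      have h1 := isOnePointExt_subEmb X a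
      rw [← markedClass_of_mem hX, quotientToTheta_markedClass hF hX h1,
        thetaToQuotient_thetaFun hF hX, embWeight_onePoint (isExchangeable_markedClass hF) _ h1])

end Comparison

/-- **Theorem 2.15** (refined presentation): for a Fraïssé class `𝔉`, the assignment
`⟦X,a⟧ ↦ [X,a]` induces a ring isomorphism `P/(𝔟₀ + 𝔟₁^min + 𝔟₂^min) → Θ(𝔉)`. -/
theorem pring_min_iso_theta {σ : Signature} {F : Set (Struc σ)} (hF : IsFraisse F) :
    ∃ e : (PRing F ⧸
        (Ideal.span (B0Set F) + Ideal.span (LMinSet F) + Ideal.span (QMinSet F))) ≃+*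
      ThetaRing F,
      ∀ (X : Struc σ) (hXF : X ∈ F) (a : X.carrier)
        (W : Struc σ) (hW : W ∈ F) (g : Emb W X), IsOnePointExt g a →
        e (Ideal.Quotient.mk _ (mVar X (memUpIso_of_mem hXF) a)) =
          thetaClass W X hW hXF g := by
  refine ⟨quotientEquivTheta hF, fun X hXF a W hW g hg => ?_⟩
  rw [← markedClass_of_mem (memUpIso_of_mem hXF), ← thetaFun_of_mem hW hXF]
  exact quotientToTheta_markedClass hF (memUpIso_of_mem hXF) hg

end Paper
end

section
/- Let R be an integral domain and let A be an R-algebra that is finitely generated and free as an R-module. Suppose there is a maximal ideal 𝔪 of R such that R/𝔪 is a perfect field and the ring A ⊗_R (R/𝔪) is semisimple. Then the ring A ⊗_R Frac(R) is semisimple, where Frac(R) is the fraction field of R. -/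
open TensorProduct

attribute [local instance] Ideal.Quotient.field

/-- Cancellation of base change, for a possibly noncommutative algebra `A`. -/
noncomputable def cancelBaseChangeAlgEquiv (R S T A : Type*) [CommRing R] [CommRing S] [CommRing T]
    [Ring A] [Algebra R S] [Algebra R T] [Algebra S T] [IsScalarTower R S T] [Algebra R A] :
    T ⊗[S] (S ⊗[R] A) ≃ₐ[T] T ⊗[R] A :=
  AlgEquiv.symm <| AlgEquiv.ofLinearEquiv
    (TensorProduct.AlgebraTensorModule.cancelBaseChange R S T T A).symm
    (by simp [Algebra.TensorProduct.one_def])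
    (LinearMap.map_mul_of_map_mul_tmul (fun _ _ _ _ ↦ by simp))

theorem mem_jacobson_of_forall_isNilpotent {B : Type*} [Ring B] {x : B}
    (h : ∀ b, IsNilpotent (b * x)) : x ∈ Ring.jacobson B := by
  rw [← Ideal.jacobson_bot, Ideal.mem_jacobson_iff]
  intro b
  obtain ⟨u, hu⟩ := (h b).isUnit_one_add
  refine ⟨((u⁻¹ : Bˣ) : B), ?_⟩
  rw [Ideal.mem_bot, mul_assoc, ← mul_add_one, add_comm, ← hu, Units.inv_mul, sub_self]

theorem isNilpotent_of_mem_jacobson {B : Type*} [Ring B] [IsArtinianRing B] {x : B}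
    (h : x ∈ Ring.jacobson B) : IsNilpotent x := by
  obtain ⟨n, hn⟩ := IsSemiprimaryRing.isNilpotent (R := B)
  have := Ideal.pow_mem_pow h n
  rw [hn] at this
  exact ⟨n, this⟩

theorem IsSemisimpleRing.exists_mem_center_of_ne_bot {B : Type*} [Ring B] [IsSemisimpleRing B]
    (I : Ideal B) [I.IsTwoSided] (hI : I ≠ ⊥) : ∃ e ∈ I, e ≠ 0 ∧ ∀ b, b * e = e * b := by
  obtain ⟨L, hL⟩ := exists_isCompl I
  obtain ⟨e, he, f, hf, hef⟩ :=
    Submodule.mem_sup.mp (hL.sup_eq_top ▸ Submodule.mem_top : (1 : B) ∈ I ⊔ L)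
  have hr (x : B) (hx : x ∈ I) : x * e = x := by
    have h0 : x * f = 0 := by
      have : x * f ∈ I ⊓ L := ⟨I.mul_mem_right _ hx, L.mul_mem_left _ hf⟩
      rwa [hL.inf_eq_bot] at this
    rw [← add_zero (x * e), ← h0, ← mul_add, hef, mul_one]
  have hl (x : B) (hx : x ∈ I) : e * x = x := by
    have hy : x - e * x ∈ I := I.sub_mem hx (I.mul_mem_left _ hx)
    have h0 : ∀ z ∈ I, z * (x - e * x) = 0 := fun z hz ↦ by
      rw [mul_sub, ← mul_assoc, hr z hz, sub_self]
    have hJ : x - e * x ∈ Ring.jacobson B := by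
      refine mem_jacobson_of_forall_isNilpotent fun b ↦ ⟨2, ?_⟩
      rw [pow_two, ← mul_assoc, h0 _ (I.mul_mem_right _ (I.mul_mem_left _ hy))]
    rw [IsSemisimpleRing.jacobson_eq_bot, Submodule.mem_bot, sub_eq_zero] at hJ
    exact hJ.symm
  refine ⟨e, he, ?_, fun b ↦ ?_⟩
  · rintro rfl
    exact hI ((Submodule.eq_bot_iff _).mpr fun x hx ↦ by rw [← hr x hx, mul_zero])
  · rw [← hl _ (I.mul_mem_left b he), ← mul_assoc, hr _ (I.mul_mem_right b he)]

theorem isReduced_tensorProduct_of_perfectField (k L Z : Type*) [Field k] [PerfectField k]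
    [Field L] [Algebra k L] [CommRing Z] [Algebra k Z] [Module.Finite k Z] [IsReduced Z] :
    IsReduced (L ⊗[k] Z) := by
  have : IsArtinianRing Z := isArtinian_of_tower k inferInstance
  have : Algebra.FormallyUnramified k Z := by
    have (m : MaximalSpectrum Z) : Algebra.FormallyUnramified k (Z ⧸ m.asIdeal) :=
      letI := Ideal.Quotient.field m.asIdeal
      Algebra.FormallyUnramified.of_isSeparable k _
    exact .of_equiv ((IsArtinianRing.equivPi Z).restrictScalars k).symm
  exact Algebra.FormallyUnramified.isReduced_of_field L _

theorem isReduced_center (k B : Type*) [CommRing k] [Ring B] [Algebra k B] [IsSemisimpleRing B] :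
    IsReduced (Subalgebra.center k B) where
  eq_zero z := by
    rintro ⟨n, hn⟩
    have hz : (z : B) ∈ Ring.jacobson B := mem_jacobson_of_forall_isNilpotent fun b ↦ ⟨n, by
      rw [Commute.mul_pow (Subalgebra.mem_center_iff.mp z.2 b), ← SubmonoidClass.coe_pow, hn,
        ZeroMemClass.coe_zero, mul_zero]⟩
    rw [IsSemisimpleRing.jacobson_eq_bot, Submodule.mem_bot] at hz
    exact Subtype.ext hz

section Coordinates

variable {k L B ι : Type*} [CommRing k] [CommRing L] [Algebra k L] [Ring B] [Algebra k B]
  [DecidableEq ι] (t : Module.Basis ι k L)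

theorem equivFinsuppOfBasisLeft_one_tmul_mul (d : B) (x : L ⊗[k] B) (i : ι) :
    TensorProduct.equivFinsuppOfBasisLeft t (1 ⊗ₜ d * x) i =
      d * TensorProduct.equivFinsuppOfBasisLeft t x i := by
  induction x with
  | zero => simp
  | tmul l b => simp
  | add x y hx hy => simp [mul_add, hx, hy]

theorem equivFinsuppOfBasisLeft_mul_one_tmul (d : B) (x : L ⊗[k] B) (i : ι) :
    TensorProduct.equivFinsuppOfBasisLeft t (x * 1 ⊗ₜ d) i =
      TensorProduct.equivFinsuppOfBasisLeft t x i * d := by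
  induction x with
  | zero => simp
  | tmul l b => simp
  | add x y hx hy => simp [add_mul, hx, hy]

/-- A nonzero two-sided ideal of `L ⊗ B`, with `B` semisimple, contains a nonzero element with
central coordinates. -/
theorem exists_mem_forall_coord_mem_center [IsSemisimpleRing B] (J : Ideal (L ⊗[k] B))
    [J.IsTwoSided] (hJ : J ≠ ⊥) :
    ∃ y ∈ J, y ≠ 0 ∧
      ∀ i, TensorProduct.equivFinsuppOfBasisLeft t y i ∈ Subalgebra.center k B := by
  set Φ := TensorProduct.equivFinsuppOfBasisLeft (N := B) t
  obtain ⟨x, ⟨hxJ, hx0⟩, hmin⟩ := exists_minimalFor_of_wellFoundedLT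
    (fun x ↦ x ∈ J ∧ x ≠ 0) (fun x ↦ (Φ x).support.card) (Submodule.exists_mem_ne_zero_of_ne_bot hJ)
  obtain ⟨i₀, hi₀⟩ : ∃ i, Φ x i ≠ 0 := by
    by_contra! h
    exact hx0 (Φ.map_eq_zero_iff.mp (Finsupp.ext h))
  let I : Ideal B :=
    { carrier := {c | ∃ y ∈ J, (∀ i, Φ x i = 0 → Φ y i = 0) ∧ Φ y i₀ = c}
      add_mem' := by
        rintro _ _ ⟨y, hy, hys, rfl⟩ ⟨z, hz, hzs, rfl⟩
        exact ⟨y + z, J.add_mem hy hz, fun i hi ↦ by simp [hys i hi, hzs i hi], by simp⟩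
      zero_mem' := ⟨0, J.zero_mem, by simp, by simp⟩
      smul_mem' := by
        rintro d _ ⟨y, hy, hys, rfl⟩
        refine ⟨1 ⊗ₜ d * y, J.mul_mem_left _ hy, fun i hi ↦ ?_, ?_⟩
        · rw [equivFinsuppOfBasisLeft_one_tmul_mul, hys i hi, mul_zero]
        · rw [equivFinsuppOfBasisLeft_one_tmul_mul, smul_eq_mul] }
  have : I.IsTwoSided := ⟨by
    rintro _ d ⟨y, hy, hys, rfl⟩
    refine ⟨y * 1 ⊗ₜ d, J.mul_mem_right _ hy, fun i hi ↦ ?_, ?_⟩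
    · rw [equivFinsuppOfBasisLeft_mul_one_tmul, hys i hi, zero_mul]
    · rw [equivFinsuppOfBasisLeft_mul_one_tmul]⟩
  have hI : I ≠ ⊥ := fun h ↦ hi₀ <| by
    rw [← Submodule.mem_bot B, ← h]
    exact ⟨x, hxJ, fun _ ↦ id, rfl⟩
  obtain ⟨_, ⟨y, hy, hys, rfl⟩, he0, hec⟩ := IsSemisimpleRing.exists_mem_center_of_ne_bot I hI
  refine ⟨y, hy, by rintro rfl; simp at he0, fun i ↦ Subalgebra.mem_center_iff.mpr fun d ↦ ?_⟩
  have hc (i : ι) : Φ (1 ⊗ₜ d * y - y * 1 ⊗ₜ d) i = d * Φ y i - Φ y i * d := by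
    rw [map_sub, Finsupp.sub_apply, equivFinsuppOfBasisLeft_one_tmul_mul,
      equivFinsuppOfBasisLeft_mul_one_tmul]
  suffices h : 1 ⊗ₜ d * y - y * 1 ⊗ₜ d = 0 by
    rw [← sub_eq_zero, ← hc, h, map_zero, Finsupp.zero_apply]
  by_contra h
  have hlt : (Φ (1 ⊗ₜ d * y - y * 1 ⊗ₜ d)).support.card < (Φ x).support.card := by
    refine Finset.card_lt_card (Finset.ssubset_iff_of_subset (fun i hi ↦ ?_) |>.mpr
      ⟨i₀, Finsupp.mem_support_iff.mpr hi₀, ?_⟩)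
    · rw [Finsupp.mem_support_iff, hc] at hi
      refine Finsupp.mem_support_iff.mpr fun h0 ↦ hi ?_
      rw [hys i h0, mul_zero, zero_mul, sub_zero]
    · rw [Finsupp.notMem_support_iff, hc, hec, sub_self]
  exact hlt.not_ge (hmin ⟨J.sub_mem (J.mul_mem_left _ hy) (J.mul_mem_right _ hy), h⟩ hlt.le)

end Coordinates

/-- Semisimplicity of a finite-dimensional algebra over a perfect field is preserved by arbitrary
field extensions. -/
theorem isSemisimpleRing_tensorProduct_of_perfectField (k L B : Type*) [Field k] [PerfectField k]
    [Field L] [Algebra k L] [Ring B] [Algebra k B] [Module.Finite k B] [IsSemisimpleRing B] :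
    IsSemisimpleRing (L ⊗[k] B) := by
  classical
  have : IsArtinianRing (L ⊗[k] B) := isArtinian_of_tower L inferInstance
  rw [IsArtinianRing.isSemisimpleRing_iff_jacobson]
  by_contra hJ
  let t := Module.Basis.ofVectorSpace k L
  obtain ⟨y, hy, hy0, hyc⟩ := exists_mem_forall_coord_mem_center t _ hJ
  let Z := Subalgebra.center k B
  have := isReduced_center k B
  have := isReduced_tensorProduct_of_perfectField k L Z
  let f : L ⊗[k] Z →ₐ[k] L ⊗[k] B := Algebra.TensorProduct.map (AlgHom.id k L) Z.val
  have hf : Function.Injective f :=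
    Module.Flat.lTensor_preserves_injective_linearMap Z.val.toLinearMap Subtype.val_injective
  obtain ⟨z, rfl⟩ : y ∈ f.range := by
    rw [← (TensorProduct.equivFinsuppOfBasisLeft t).symm_apply_apply y,
      TensorProduct.equivFinsuppOfBasisLeft_symm_apply]
    exact sum_mem fun i _ ↦ ⟨t i ⊗ₜ ⟨_, hyc i⟩, rfl⟩
  have hz : IsNilpotent z := (IsNilpotent.map_iff hf).mp (isNilpotent_of_mem_jacobson hy)
  exact hy0 (by rw [hz.eq_zero]; exact map_zero f)

theorem ValuationRing.exists_forall_exists_algebraMap_mul_eq (V K : Type*) [CommRing V] [IsDomain V]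
    [ValuationRing V] [Field K] [Algebra V K] [IsFractionRing V K] {ι : Type*} [Finite ι]
    {c : ι → K} (hc : c ≠ 0) : ∃ i, c i ≠ 0 ∧ ∀ j, ∃ a : V, algebraMap V K a * c i = c j := by
  obtain ⟨i₁, hi₁⟩ := Function.ne_iff.mp hc
  have : Nonempty ι := ⟨i₁⟩
  obtain ⟨i, hi⟩ := Finite.exists_max fun i ↦ ValuationRing.valuation V K (c i)
  have hi0 : c i ≠ 0 := by
    intro h0
    have := hi i₁
    rw [h0, map_zero, le_zero_iff, map_eq_zero] at this
    exact hi₁ this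
  refine ⟨i, hi0, fun j ↦ ?_⟩
  have : c j * (c i)⁻¹ ∈ (ValuationRing.valuation V K).integer := by
    rw [Valuation.mem_integer_iff, map_mul, map_inv₀]
    exact mul_inv_le_one_of_le₀ (hi j) zero_le
  obtain ⟨a, ha⟩ := (ValuationRing.mem_integer_iff V K _).mp this
  exact ⟨a, by rw [ha, inv_mul_cancel_right₀ hi0]⟩

/-- If the special fibre of a finite free algebra over a valuation ring is semisimple, then so is
the generic fibre. -/
theorem ValuationRing.isSemisimpleRing_fractionField_tensorProduct (V K B : Type*) [CommRing V]
    [IsDomain V] [ValuationRing V] [Field K] [Algebra V K] [IsFractionRing V K] [Ring B]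
    [Algebra V B] [Module.Finite V B] [Module.Free V B]
    [IsSemisimpleRing (IsLocalRing.ResidueField V ⊗[V] B)] : IsSemisimpleRing (K ⊗[V] B) := by
  have : IsArtinianRing (K ⊗[V] B) := isArtinian_of_tower K inferInstance
  rw [IsArtinianRing.isSemisimpleRing_iff_jacobson, Submodule.eq_bot_iff]
  intro x hx
  by_contra hx0
  let κ := IsLocalRing.ResidueField V
  let b := Module.Free.chooseBasis V B
  let β := b.baseChange K
  obtain ⟨i, hi, hdiv⟩ := ValuationRing.exists_forall_exists_algebraMap_mul_eq V K
    (c := ⇑(β.repr x)) fun h ↦ hx0 (β.repr.map_eq_zero_iff.mp (DFunLike.coe_injective h))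
  choose a ha using hdiv
  let y : B := ∑ j, a j • b j
  let toK : B →ₐ[V] K ⊗[V] B := Algebra.TensorProduct.includeRight
  let toκ : B →ₐ[V] κ ⊗[V] B := Algebra.TensorProduct.includeRight
  have htoK : Function.Injective toK :=
    Algebra.TensorProduct.includeRight_injective (IsFractionRing.injective V K)
  have htoκ : Function.Surjective toκ :=
    Algebra.TensorProduct.includeRight_surjective B
      (IsLocalRing.residue_surjective : Function.Surjective (algebraMap V κ))
  have hxy : x = (β.repr x i) • toK y := by
    conv_lhs => rw [← β.sum_repr x]
    simp only [y, toK, map_sum, map_smul, Finset.smul_sum]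
    refine Finset.sum_congr rfl fun j _ ↦ ?_
    rw [← ha j, mul_comm, mul_smul, algebraMap_smul, Module.Basis.baseChange_apply]
    rfl
  have hyJ : toK y ∈ Ring.jacobson (K ⊗[V] B) := by
    have := (Ring.jacobson (K ⊗[V] B)).mul_mem_left (algebraMap K _ (β.repr x i)⁻¹) hx
    rwa [← Algebra.smul_def, inv_smul_eq_iff₀ hi |>.mpr hxy] at this
  have hyκ : toκ y ∈ Ring.jacobson (κ ⊗[V] B) := by
    refine mem_jacobson_of_forall_isNilpotent fun d ↦ ?_
    obtain ⟨d, rfl⟩ := htoκ d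
    rw [← map_mul]
    refine IsNilpotent.map ((IsNilpotent.map_iff htoK).mp ?_) toκ
    rw [map_mul]
    exact isNilpotent_of_mem_jacobson (Ideal.mul_mem_left _ _ hyJ)
  have hai : a i = 1 := by
    apply IsFractionRing.injective V K
    rw [map_one]
    exact mul_right_cancel₀ hi (by rw [ha, one_mul])
  rw [IsSemisimpleRing.jacobson_eq_bot, Submodule.mem_bot] at hyκ
  have h1 : (b.baseChange κ).repr (toκ y) i = 1 := by
    change (b.baseChange κ).repr (1 ⊗ₜ y) i = 1
    rw [Module.Basis.baseChange_repr_tmul, b.repr_sum_self, hai, one_smul]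
  rw [hyκ, map_zero, Finsupp.zero_apply] at h1
  exact zero_ne_one h1

/-- A valuation subring of the fraction field of `R` dominating `R` at the maximal ideal `𝔪`. -/
theorem exists_valuationSubring_forall_mem_maximalIdeal {R K : Type*} [CommRing R] [Field K]
    [Algebra R K] [FaithfulSMul R K] (𝔪 : Ideal R) (h𝔪 : 𝔪 ≠ ⊤) :
    ∃ (V : ValuationSubring K) (f : R →+* V), (∀ r, (f r : K) = algebraMap R K r) ∧
      ∀ r ∈ 𝔪, f r ∈ IsLocalRing.maximalIdeal V := by
  have hbij : Function.Bijective (algebraMap R K).rangeRestrict :=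
    ⟨fun a b h ↦ FaithfulSMul.algebraMap_injective R K (congrArg Subtype.val h),
      (algebraMap R K).rangeRestrict_surjective⟩
  have hI : 𝔪.map (algebraMap R K).rangeRestrict ≠ ⊤ := fun h ↦ h𝔪 <| by
    rw [← Ideal.comap_map_of_bijective _ hbij (I := 𝔪), h, Ideal.comap_top]
  obtain ⟨V, hV, hVI⟩ := Ideal.image_subset_nonunits_valuationSubring _ hI
  refine ⟨V, (algebraMap R K).codRestrict V fun r ↦ hV ⟨r, rfl⟩, fun r ↦ rfl, fun r hr ↦ ?_⟩
  have := hVI ⟨_, Ideal.mem_map_of_mem _ hr, rfl⟩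
  rw [← V.image_maximalIdeal] at this
  obtain ⟨v, hv, hvr⟩ := this
  convert hv
  exact Subtype.ext hvr.symm

/-- Tits deformation style semisimplicity transfer: if `A` is a finite free algebra over a
domain `R`, and `A ⊗ R/𝔪` is semisimple for some maximal ideal `𝔪` with perfect residue
field, then `A ⊗ Frac(R)` is semisimple. -/
theorem semisimple_of_semisimple_residue
    (R : Type*) [CommRing R] [IsDomain R]
    (A : Type*) [Ring A] [Algebra R A]
    [Module.Finite R A] [Module.Free R A]
    (𝔪 : Ideal R) [𝔪.IsMaximal]
    (hperf : PerfectField (R ⧸ 𝔪))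
    (hss : IsSemisimpleRing (A ⊗[R] (R ⧸ 𝔪))) :
    IsSemisimpleRing (A ⊗[R] (FractionRing R)) := by
  let K := FractionRing R
  let k := R ⧸ 𝔪
  obtain ⟨V, f, hf, hf𝔪⟩ :=
    exists_valuationSubring_forall_mem_maximalIdeal (K := K) 𝔪 (Ideal.IsMaximal.ne_top ‹_›)
  let κ := IsLocalRing.ResidueField V
  algebraize [f]
  have : IsScalarTower R V K := .of_algebraMap_eq fun r ↦ (hf r).symm
  let g : k →+* κ := Ideal.Quotient.lift 𝔪 (algebraMap R κ) fun r hr ↦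
    (IsLocalRing.residue_eq_zero_iff _).mpr (hf𝔪 r hr)
  let : Algebra k κ := g.toAlgebra
  have : IsScalarTower R k κ := .of_algebraMap_eq fun r ↦ rfl
  have : IsSemisimpleRing (k ⊗[R] A) :=
    (Algebra.TensorProduct.comm R A k).toRingEquiv.isSemisimpleRing
  have : IsSemisimpleRing (κ ⊗[k] (k ⊗[R] A)) := isSemisimpleRing_tensorProduct_of_perfectField ..
  have : IsSemisimpleRing (κ ⊗[V] (V ⊗[R] A)) :=
    ((cancelBaseChangeAlgEquiv R k κ A).toRingEquiv.trans
      (cancelBaseChangeAlgEquiv R V κ A).symm.toRingEquiv).isSemisimpleRing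
  have : IsSemisimpleRing (K ⊗[V] (V ⊗[R] A)) :=
    ValuationRing.isSemisimpleRing_fractionField_tensorProduct ..
  exact ((cancelBaseChangeAlgEquiv R V K A).toRingEquiv.trans
    (Algebra.TensorProduct.comm R K A).toRingEquiv).isSemisimpleRing
end
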